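/- arXiv:1604.00870 — 2 statements merged into one kernel-verified Lean document; each statement's English description precedes it below -/
import Mathlib

section
/- Let X_3(n) be the linear particle system on Ω_{a,b,c} with three particle types A, B, C of strengths 0 < s_A < s_B < s_C satisfying s_A/s_B < 1/2 and s_B/s_C < 1/2, where n = a + b + c. Then there is a constant C, depending only on the ratios s_A/s_B and s_B/s_C (and not on n, a, b, c), such that the mixing time satisfies t(X_3(n)) ≤ C·n^{10}. -/
open Finset

/-- Total-variation mixing time: the least `T` such that for every starting state `x`
and every `t ≥ T`, the TV distance between `P^t(x, ·)` and `π` is at most `1/4`. -/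
noncomputable def mixingTime {Ω : Type*} [Fintype Ω] [DecidableEq Ω]
    (P : Matrix Ω Ω ℝ) (π : Ω → ℝ) : ℕ :=
  sInf {T : ℕ | ∀ x : Ω, ∀ t : ℕ, T ≤ t →
    (1 / 2) * ∑ y : Ω, |(P ^ t) x y - π y| ≤ 1 / 4}

/-- State space `Ω_{n₁,…,n_k}` of the linear particle system: words of length `n`
over `{1,…,k}` with exactly `cnt j` letters equal to `j`. -/
abbrev PSpace (n k : ℕ) (cnt : Fin k → ℕ) : Type :=
  {w : Fin n → Fin k // ∀ j : Fin k, (Finset.univ.filter fun i => w i = j).card = cnt j}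

/-- Transition matrix of the linear particle system `X_k(n)`: from state `v`, a
position `i` with `i+1 < n` is chosen uniformly; if the two letters are equal nothing
happens, otherwise they are swapped with probability `s(v i)/(s(v i)+s(v (i+1)))`. -/
noncomputable def partP (n k : ℕ) (cnt : Fin k → ℕ) (s : Fin k → ℝ) :
    Matrix (PSpace n k cnt) (PSpace n k cnt) ℝ :=
  fun v u => (1 / ((n : ℝ) - 1)) * ∑ i : Fin n, ∑ j : Fin n,
    if (j : ℕ) = (i : ℕ) + 1 then
      if v.1 i = v.1 j then (if u = v then 1 else 0)
      else
        (s (v.1 i) / (s (v.1 i) + s (v.1 j))) *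
          (if u.1 = v.1 ∘ Equiv.swap i j then 1 else 0)
        + (s (v.1 j) / (s (v.1 i) + s (v.1 j))) *
          (if u = v then 1 else 0)
    else 0

/-- Unnormalized stationary weight of the linear particle system:
`w(v) = ∏_i s(v i)^i` (positions counted `1,…,n`). -/
noncomputable def partW (n k : ℕ) (cnt : Fin k → ℕ) (s : Fin k → ℝ)
    (v : PSpace n k cnt) : ℝ :=
  ∏ i : Fin n, s (v.1 i) ^ ((i : ℕ) + 1)

/-- Stationary distribution of the linear particle system. -/
noncomputable def partPi (n k : ℕ) (cnt : Fin k → ℕ) (s : Fin k → ℝ)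
    (v : PSpace n k cnt) : ℝ :=
  partW n k cnt s v / ∑ u : PSpace n k cnt, partW n k cnt s u

theorem sum_eq_zero_of_involutive {Ω : Type*} [Fintype Ω] {σ : Ω → Ω}
    (hσ : Function.Involutive σ) {T : Ω → ℝ} (h : ∀ v, T v + T (σ v) = 0) : ∑ v, T v = 0 := by
  have h1 : ∑ v, T (σ v) = ∑ v, T v := Equiv.sum_comp hσ.toPerm T
  have h2 : ∑ v, (T v + T (σ v)) = 0 := Finset.sum_eq_zero fun v _ => h v
  rw [Finset.sum_add_distrib, h1] at h2
  linarith

/-- A heat-bath update along an involution decreases the weighted second moment by exactly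
its Dirichlet form. -/
theorem sum_sq_heatBath {Ω : Type*} [Fintype Ω] {σ : Ω → Ω} (hσ : Function.Involutive σ)
    {w p : Ω → ℝ} (hp : ∀ v, p (σ v) = 1 - p v) (hw : ∀ v, w v * p v = w (σ v) * p (σ v))
    (f : Ω → ℝ) :
    ∑ v, w v * (p v * f (σ v) + (1 - p v) * f v) ^ 2 =
      ∑ v, w v * f v ^ 2 - (1 / 2) * ∑ v, w v * p v * (f v - f (σ v)) ^ 2 := by
  have key := sum_eq_zero_of_involutive hσ
    (T := fun v => w v * (p v * f (σ v) + (1 - p v) * f v) ^ 2 - w v * f v ^ 2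
      + (1 / 2) * (w v * p v * (f v - f (σ v)) ^ 2)) (by
    intro v
    have h1 := hw v
    simp only [hσ v, hp v] at h1 ⊢
    linear_combination ((f v - f (σ v)) * (p v * (f v - f (σ v)) - 2 * f v)
      + (1 / 2) * (f v - f (σ v)) ^ 2) * h1)
  simp only [Finset.sum_add_distrib, Finset.sum_sub_distrib, ← Finset.mul_sum] at key
  linarith

/-- Second-moment contraction for an average of heat-bath updates satisfying a Poincaré
inequality. -/
theorem sum_sq_average_heatBath_le {Ω ι : Type*} [Fintype Ω] [Fintype ι] [Nonempty ι]
    {σ : ι → Ω → Ω} (hσ : ∀ i, Function.Involutive (σ i)) {w : Ω → ℝ} {p : ι → Ω → ℝ}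
    (hw0 : ∀ v, 0 < w v)
    (hp : ∀ i v, p i (σ i v) = 1 - p i v)
    (hw : ∀ i v, w v * p i v = w (σ i v) * p i (σ i v)) {Λ : ℝ} (hΛ : 0 < Λ) (f : Ω → ℝ)
    (hf : ∑ v, w v * f v ^ 2 ≤ Λ * ∑ i, ∑ v, w v * p i v * (f v - f (σ i v)) ^ 2) :
    ∑ v, w v * ((1 / (Fintype.card ι : ℝ)) *
        ∑ i, (p i v * f (σ i v) + (1 - p i v) * f v)) ^ 2 ≤
      (1 - 1 / (2 * Λ * Fintype.card ι)) * ∑ v, w v * f v ^ 2 := by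
  set m : ℝ := (Fintype.card ι : ℝ) with hm
  have hm0 : 0 < m := Nat.cast_pos.mpr Fintype.card_pos
  set V := ∑ v, w v * f v ^ 2
  set D := ∑ i, ∑ v, w v * p i v * (f v - f (σ i v)) ^ 2 with hD
  have h1 : ∑ v, w v * ((1 / m) * ∑ i, (p i v * f (σ i v) + (1 - p i v) * f v)) ^ 2 ≤
      ∑ v, w v * ((1 / m) * ∑ i, (p i v * f (σ i v) + (1 - p i v) * f v) ^ 2) := by
    refine Finset.sum_le_sum fun v _ => mul_le_mul_of_nonneg_left ?_ (hw0 v).le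
    have h := sq_sum_le_card_mul_sum_sq (s := (Finset.univ : Finset ι))
      (f := fun i => p i v * f (σ i v) + (1 - p i v) * f v)
    rw [Finset.card_univ, ← hm] at h
    rw [mul_pow, div_pow, one_pow]
    calc _ ≤ 1 / m ^ 2 * (m * ∑ i, (p i v * f (σ i v) + (1 - p i v) * f v) ^ 2) := by gcongr
      _ = _ := by rw [← mul_assoc]; congr 1; field_simp
  have h2 : ∑ v, w v * ((1 / m) * ∑ i, (p i v * f (σ i v) + (1 - p i v) * f v) ^ 2) =
      V - (1 / (2 * m)) * D := by
    calc _ = (1 / m) * ∑ i, ∑ v, w v * (p i v * f (σ i v) + (1 - p i v) * f v) ^ 2 := by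
          rw [Finset.sum_comm, Finset.mul_sum]
          refine Finset.sum_congr rfl fun v _ => ?_
          rw [Finset.mul_sum, Finset.mul_sum, Finset.mul_sum]
          exact Finset.sum_congr rfl fun i _ => by ring
      _ = (1 / m) * ∑ i, (V - (1 / 2) * ∑ v, w v * p i v * (f v - f (σ i v)) ^ 2) := by
          simp only [sum_sq_heatBath (hσ _) (hp _) (hw _), V]
      _ = _ := by
          rw [Finset.sum_sub_distrib, ← Finset.mul_sum, Finset.sum_const, Finset.card_univ,
            nsmul_eq_mul, ← hm, ← hD]
          field_simp
  rw [h2] at h1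
  refine h1.trans ?_
  have h3 : 1 / (2 * Λ * m) * V ≤ 1 / (2 * m) * D := by
    rw [div_mul_eq_mul_div, div_mul_eq_mul_div, div_le_div_iff₀ (by positivity) (by positivity)]
    nlinarith [mul_le_mul_of_nonneg_left hf hm0.le]
  linarith

/-- A Poincaré inequality from a relation `R` moving every state but one, whose
`h`-weighted inflow is subcritical. -/
theorem sum_sq_le_of_subcritical {Ω ι : Type*} [Fintype Ω] [Fintype ι]
    {σ : ι → Ω → Ω} (hσ : ∀ i, Function.Involutive (σ i)) {w h : Ω → ℝ}
    (R : Ω → ι → Prop) [∀ v i, Decidable (R v i)] (hw0 : ∀ v, 0 < w v) {M r : ℝ} (hr0 : 0 < r)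
    (hr1 : r < 1) (hh1 : ∀ v, 1 ≤ h v) (hhM : ∀ v, h v ≤ M)
    (hflow : ∀ x, ∑ i, (if R (σ i x) i then w (σ i x) * h (σ i x) else 0) ≤ r * (w x * h x))
    (x₀ : Ω) (hR : ∀ v, v ≠ x₀ → ∃ i, R v i) (f : Ω → ℝ) (hf : ∑ v, w v * f v = 0) :
    ∑ v, w v * f v ^ 2 ≤ (2 * (1 + r) * M / (1 - r) ^ 2) *
      ∑ i, ∑ v, (if R v i then w v * (f v - f (σ i v)) ^ 2 else 0) := by
  set g : Ω → ℝ := fun v => f v - f x₀ with hg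
  set ε : ℝ := (1 - r) / (2 * r) with hε
  have hε0 : 0 < ε := div_pos (by linarith) (by linarith)
  set D := ∑ i, ∑ v, (if R v i then w v * (f v - f (σ i v)) ^ 2 else 0) with hD
  set G := ∑ v, w v * h v * g v ^ 2 with hG
  have hh0 : ∀ v, 0 < h v := fun v => by linarith [hh1 v]
  have hfg : ∑ v, w v * f v ^ 2 ≤ ∑ v, w v * g v ^ 2 := by
    have : ∑ v, w v * g v ^ 2 = ∑ v, w v * f v ^ 2 - 2 * f x₀ * ∑ v, w v * f v
        + f x₀ ^ 2 * ∑ v, w v := by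
      rw [Finset.mul_sum, Finset.mul_sum, ← Finset.sum_sub_distrib, ← Finset.sum_add_distrib]
      exact Finset.sum_congr rfl fun v _ => by simp only [hg]; ring
    rw [this, hf]
    have : 0 ≤ f x₀ ^ 2 * ∑ v, w v :=
      mul_nonneg (sq_nonneg _) (Finset.sum_nonneg fun v _ => (hw0 v).le)
    linarith
  have hgG : ∑ v, w v * g v ^ 2 ≤ G := by
    refine Finset.sum_le_sum fun v _ => ?_
    have := mul_nonneg (hw0 v).le (sq_nonneg (g v))
    nlinarith [hh1 v]
  have hstep : G ≤ ∑ v, ∑ i, (if R v i then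
      (1 + ε) * (w v * h v * g (σ i v) ^ 2) + (1 + 1 / ε) * M * (w v * (f v - f (σ i v)) ^ 2)
      else 0) := by
    refine Finset.sum_le_sum fun v _ => ?_
    have hM : 0 < M := (hh0 v).trans_le (hhM v)
    have hnn : ∀ i, 0 ≤ (if R v i then
      (1 + ε) * (w v * h v * g (σ i v) ^ 2) + (1 + 1 / ε) * M * (w v * (f v - f (σ i v)) ^ 2)
      else 0) := by
      intro i
      have := hw0 v
      have := hh0 v
      split_ifs <;> positivity
    by_cases hv : v = x₀
    · have : g v = 0 := by simp [hg, hv]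
      rw [this]
      simpa using Finset.sum_nonneg fun i _ => hnn i
    · obtain ⟨i, hi⟩ := hR v hv
      refine le_trans ?_ (Finset.single_le_sum (fun i _ => hnn i) (Finset.mem_univ i))
      rw [if_pos hi]
      have h1 : g v ^ 2 ≤ (1 + ε) * g (σ i v) ^ 2 + (1 + 1 / ε) * (f v - f (σ i v)) ^ 2 := by
        have e : g v = g (σ i v) + (f v - f (σ i v)) := by simp only [hg]; ring
        rw [e]
        set a := g (σ i v)
        set b := f v - f (σ i v)
        have : 0 ≤ (ε * a - b) ^ 2 / ε := by positivity
        have e2 : (ε * a - b) ^ 2 / ε = ε * a ^ 2 - 2 * a * b + 1 / ε * b ^ 2 := by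
          field_simp
          ring
        nlinarith
      have hwh : 0 ≤ w v * h v := (mul_pos (hw0 v) (hh0 v)).le
      have h2 := mul_le_mul_of_nonneg_left h1 hwh
      have h3 : h v * ((1 + 1 / ε) * (w v * (f v - f (σ i v)) ^ 2)) ≤
          M * ((1 + 1 / ε) * (w v * (f v - f (σ i v)) ^ 2)) := by
        have := hw0 v
        exact mul_le_mul_of_nonneg_right (hhM v) (by positivity)
      nlinarith
  have hsplit : (∑ v, ∑ i, (if R v i then
      (1 + ε) * (w v * h v * g (σ i v) ^ 2) + (1 + 1 / ε) * M * (w v * (f v - f (σ i v)) ^ 2)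
      else 0)) = (1 + ε) * (∑ i, ∑ v, if R v i then w v * h v * g (σ i v) ^ 2 else 0)
        + (1 + 1 / ε) * M * D := by
    rw [Finset.sum_comm, hD, Finset.mul_sum, Finset.mul_sum, ← Finset.sum_add_distrib]
    refine Finset.sum_congr rfl fun i _ => ?_
    rw [Finset.mul_sum, Finset.mul_sum, ← Finset.sum_add_distrib]
    refine Finset.sum_congr rfl fun v _ => ?_
    split_ifs <;> ring
  have hinflow : (∑ i, ∑ v, if R v i then w v * h v * g (σ i v) ^ 2 else 0) ≤ r * G := by
    calc (∑ i, ∑ v, if R v i then w v * h v * g (σ i v) ^ 2 else 0)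
        = ∑ i, ∑ x, (if R (σ i x) i then w (σ i x) * h (σ i x) else 0) * g x ^ 2 := by
          refine Finset.sum_congr rfl fun i _ => ?_
          rw [← Equiv.sum_comp (hσ i).toPerm]
          refine Finset.sum_congr rfl fun x _ => ?_
          simp only [Function.Involutive.coe_toPerm, hσ i x]
          split_ifs <;> ring
      _ = ∑ x, (∑ i, (if R (σ i x) i then w (σ i x) * h (σ i x) else 0)) * g x ^ 2 := by
          rw [Finset.sum_comm]
          exact Finset.sum_congr rfl fun x _ => by rw [Finset.sum_mul]
      _ ≤ ∑ x, r * (w x * h x) * g x ^ 2 :=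
          Finset.sum_le_sum fun x _ => mul_le_mul_of_nonneg_right (hflow x) (sq_nonneg _)
      _ = r * G := by
          rw [hG, Finset.mul_sum]
          exact Finset.sum_congr rfl fun x _ => by ring
  rw [hsplit] at hstep
  have h1r : 0 < 1 - r := by linarith
  have hfin : G ≤ (1 + ε) * (r * G) + (1 + 1 / ε) * M * D := by
    have := mul_le_mul_of_nonneg_left hinflow (by positivity : 0 ≤ 1 + ε)
    linarith
  have e1 : (1 + ε) * r = (1 + r) / 2 := by rw [hε]; field_simp; ring
  have e2 : 1 + 1 / ε = (1 + r) / (1 - r) := by rw [hε]; field_simp; ring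
  have : (1 - r) / 2 * G ≤ (1 + r) / (1 - r) * M * D := by
    rw [← e2]
    have : (1 + ε) * (r * G) = (1 + r) / 2 * G := by rw [← e1]; ring
    linarith
  have : G ≤ 2 * (1 + r) * M / (1 - r) ^ 2 * D := by
    have h2 := mul_le_mul_of_nonneg_left this (by positivity : 0 ≤ 2 / (1 - r))
    calc G = 2 / (1 - r) * ((1 - r) / 2 * G) := by field_simp
      _ ≤ _ := h2
      _ = _ := by field_simp
  linarith

/-- Total-variation convergence of a reversible chain from second-moment contraction. -/
theorem half_sum_abs_pow_sub_le {Ω : Type*} [Fintype Ω] [DecidableEq Ω]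
    {P : Matrix Ω Ω ℝ} {π : Ω → ℝ} (hπ0 : ∀ v, 0 < π v) (hπ1 : ∑ v, π v = 1)
    (hrev : ∀ u v, π u * P u v = π v * P v u) (hone : ∀ v, ∑ u, P v u = 1) {γ B : ℝ}
    (hcontr : ∀ f : Ω → ℝ, ∑ v, π v * f v = 0 →
      ∑ v, π v * (∑ u, P v u * f u) ^ 2 ≤ (1 - γ) * ∑ v, π v * f v ^ 2)
    (x : Ω) (hB : 1 / π x ≤ B) {t : ℕ} (ht : B * Real.exp (-γ * t) ≤ 1 / 4) :
    (1 / 2) * ∑ y, |(P ^ t) x y - π y| ≤ 1 / 4 := by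
  set k : ℕ → Ω → ℝ := fun t y => (P ^ t) x y / π y - 1 with hk
  have hkπ : ∀ t y, π y * k t y = (P ^ t) x y - π y := by
    intro t y
    have := (hπ0 y).ne'
    simp only [hk]; field_simp
  have hksucc : ∀ t y, k (t + 1) y = ∑ u, P y u * k t u := by
    intro t y
    have h1 : ∑ u, P y u * k t u = ∑ u, P y u * ((P ^ t) x u / π u) - 1 := by
      simp only [hk, mul_sub, mul_one, Finset.sum_sub_distrib, hone]
    rw [h1]
    simp only [hk]
    rw [pow_succ, Matrix.mul_apply, Finset.sum_div]
    congr 1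
    refine Finset.sum_congr rfl fun u _ => ?_
    have h2 := hrev u y
    have hu := (hπ0 u).ne'
    have hy := (hπ0 y).ne'
    field_simp
    linear_combination (P ^ t) x u * h2
  have hrow : ∀ t, ∑ y, (P ^ t) x y = 1 := by
    intro t
    induction t with
    | zero => simp [Matrix.one_apply]
    | succ t ih =>
      simp only [pow_succ, Matrix.mul_apply]
      rw [Finset.sum_comm]
      simp only [← Finset.mul_sum, hone, mul_one, ih]
  have hmean : ∀ t, ∑ y, π y * k t y = 0 := by
    intro t
    simp only [hkπ, Finset.sum_sub_distrib, hrow, hπ1, sub_self]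
  have hnorm : ∀ t : ℕ, ∑ y, π y * k t y ^ 2 ≤ B * Real.exp (-γ * t) := by
    intro t
    induction t with
    | zero =>
      have h0 : ∑ y, π y * k 0 y ^ 2 = 1 / π x - 1 := by
        have : ∀ y, π y * k 0 y ^ 2 = (if x = y then 1 / π y - 2 else 0) + π y := by
          intro y
          have := (hπ0 y).ne'
          simp only [hk, pow_zero, Matrix.one_apply]
          split_ifs
          · field_simp; ring
          · simp
        simp only [this, Finset.sum_add_distrib, hπ1]
        simp; ring
      rw [h0]; simp only [Nat.cast_zero, mul_zero, Real.exp_zero, mul_one]; linarith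
    | succ t ih =>
      simp only [hksucc]
      have hnn : 0 ≤ ∑ y, π y * k t y ^ 2 :=
        Finset.sum_nonneg fun y _ => mul_nonneg (hπ0 y).le (sq_nonneg _)
      calc _ ≤ (1 - γ) * ∑ y, π y * k t y ^ 2 := hcontr _ (hmean t)
        _ ≤ Real.exp (-γ) * ∑ y, π y * k t y ^ 2 := by
          gcongr
          linarith [Real.add_one_le_exp (-γ)]
        _ ≤ Real.exp (-γ) * (B * Real.exp (-γ * t)) := by gcongr
        _ = B * Real.exp (-γ * (t + 1 : ℕ)) := by
          rw [mul_left_comm, ← Real.exp_add]; push_cast; ring_nf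
  have hcs : (∑ y, |(P ^ t) x y - π y|) ^ 2 ≤ ∑ y, π y * k t y ^ 2 := by
    have h := Finset.sum_sq_le_sum_mul_sum_of_sq_le_mul Finset.univ
      (r := fun y => |(P ^ t) x y - π y|) (f := π) (g := fun y => π y * k t y ^ 2)
      (fun y _ => (hπ0 y).le) (fun y _ => mul_nonneg (hπ0 y).le (sq_nonneg _))
      (fun y _ => by rw [sq_abs, ← hkπ]; exact le_of_eq (by ring))
    rwa [hπ1, one_mul] at h
  have h4 : (∑ y, |(P ^ t) x y - π y|) ^ 2 ≤ (1 / 2) ^ 2 := by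
    have := hnorm t
    linarith
  have := (abs_le_of_sq_le_sq' h4 (by norm_num)).2
  linarith

/-- The word obtained by exchanging the letters at positions `i` and `i + 1`. -/
def edgeSwap {m k : ℕ} {cnt : Fin k → ℕ} (i : Fin m) (v : PSpace (m + 1) k cnt) :
    PSpace (m + 1) k cnt :=
  ⟨v.1 ∘ Equiv.swap i.castSucc i.succ, fun j => by
    rw [← v.2 j]
    exact Finset.card_equiv (Equiv.swap i.castSucc i.succ) (by simp)⟩

/-- The probability that an update of the edge `(i, i + 1)` exchanges the two letters. -/
noncomputable def swapProb {m k : ℕ} {cnt : Fin k → ℕ} (s : Fin k → ℝ) (i : Fin m)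
    (v : PSpace (m + 1) k cnt) : ℝ :=
  s (v.1 i.castSucc) / (s (v.1 i.castSucc) + s (v.1 i.succ))

theorem edgeSwap_castSucc {m k : ℕ} {cnt : Fin k → ℕ} (i : Fin m) (v : PSpace (m + 1) k cnt) :
    (edgeSwap i v).1 i.castSucc = v.1 i.succ := by
  simp [edgeSwap]

theorem edgeSwap_succ {m k : ℕ} {cnt : Fin k → ℕ} (i : Fin m) (v : PSpace (m + 1) k cnt) :
    (edgeSwap i v).1 i.succ = v.1 i.castSucc := by
  simp [edgeSwap]

theorem edgeSwap_involutive {m k : ℕ} {cnt : Fin k → ℕ} (i : Fin m) :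
    Function.Involutive (edgeSwap (k := k) (cnt := cnt) i) := by
  intro v
  ext j
  simp [edgeSwap]

theorem edgeSwap_eq_self {m k : ℕ} {cnt : Fin k → ℕ} {i : Fin m} {v : PSpace (m + 1) k cnt}
    (h : v.1 i.castSucc = v.1 i.succ) : edgeSwap i v = v := by
  apply Subtype.ext
  funext j
  simp only [edgeSwap, Function.comp_apply]
  rw [Equiv.swap_apply_def]
  split_ifs with h1 h2
  · rw [h1, h]
  · rw [h2, h]
  · rfl

theorem swapProb_edgeSwap {m k : ℕ} {cnt : Fin k → ℕ} {s : Fin k → ℝ} (hs : ∀ j, 0 < s j)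
    (i : Fin m) (v : PSpace (m + 1) k cnt) :
    swapProb s i (edgeSwap i v) = 1 - swapProb s i v := by
  simp only [swapProb, edgeSwap_castSucc, edgeSwap_succ]
  have h1 := hs (v.1 i.castSucc)
  have h2 := hs (v.1 i.succ)
  field_simp
  ring

theorem partW_pos {n k : ℕ} {cnt : Fin k → ℕ} {s : Fin k → ℝ} (hs : ∀ j, 0 < s j)
    (v : PSpace n k cnt) : 0 < partW n k cnt s v :=
  Finset.prod_pos fun _ _ => pow_pos (hs _) _

theorem partW_edgeSwap {m k : ℕ} {cnt : Fin k → ℕ} (s : Fin k → ℝ) (i : Fin m)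
    (v : PSpace (m + 1) k cnt) :
    partW (m + 1) k cnt s (edgeSwap i v) * s (v.1 i.succ) =
      partW (m + 1) k cnt s v * s (v.1 i.castSucc) := by
  have e1 : partW (m + 1) k cnt s (edgeSwap i v) =
      ∏ j, s (v.1 j) ^ ((Equiv.swap i.castSucc i.succ j : ℕ) + 1) := by
    rw [partW, ← Equiv.prod_comp (Equiv.swap i.castSucc i.succ)]
    simp [edgeSwap]
  have e2 : ∀ a : Fin (m + 1), s (v.1 a) = ∏ j, if j = a then s (v.1 j) else 1 := by
    intro a; simp
  rw [e1, partW, e2 i.succ, e2 i.castSucc, ← Finset.prod_mul_distrib, ← Finset.prod_mul_distrib]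
  refine Finset.prod_congr rfl fun j _ => ?_
  rw [Equiv.swap_apply_def]
  have hne : i.castSucc ≠ i.succ := i.castSucc_lt_succ.ne
  by_cases h1 : j = i.castSucc
  · subst h1
    simp [hne, pow_succ]
  · by_cases h2 : j = i.succ
    · subst h2
      simp [hne.symm, pow_succ]
    · simp [h1, h2]

theorem partW_mul_swapProb {m k : ℕ} {cnt : Fin k → ℕ} {s : Fin k → ℝ} (hs : ∀ j, 0 < s j)
    (i : Fin m) (v : PSpace (m + 1) k cnt) :
    partW (m + 1) k cnt s v * swapProb s i v =
      partW (m + 1) k cnt s (edgeSwap i v) * swapProb s i (edgeSwap i v) := by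
  have h := partW_edgeSwap s i v
  simp only [swapProb, edgeSwap_castSucc, edgeSwap_succ]
  have h1 := hs (v.1 i.castSucc)
  have h2 := hs (v.1 i.succ)
  field_simp
  linear_combination -(s (v.1 i.succ) + s (v.1 i.castSucc)) * h

theorem Fin.sum_sum_ite_eq_add_one {m : ℕ} (F : Fin (m + 1) → Fin (m + 1) → ℝ) :
    (∑ i : Fin (m + 1), ∑ j : Fin (m + 1), if (j : ℕ) = (i : ℕ) + 1 then F i j else 0) =
      ∑ i : Fin m, F i.castSucc i.succ := by
  rw [Fin.sum_univ_castSucc]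
  have hlast : (∑ j : Fin (m + 1),
      if (j : ℕ) = (Fin.last m : ℕ) + 1 then F (Fin.last m) j else 0) = 0 :=
    Finset.sum_eq_zero fun j _ => if_neg (by have := j.2; simp; omega)
  rw [hlast, add_zero]
  refine Finset.sum_congr rfl fun i _ => ?_
  rw [Finset.sum_eq_single i.succ]
  · simp
  · intro j _ hj
    exact if_neg fun h => hj (Fin.ext (by simpa using h))
  · simp

theorem partP_apply {m k : ℕ} {cnt : Fin k → ℕ} {s : Fin k → ℝ} (hs : ∀ j, 0 < s j)
    (v u : PSpace (m + 1) k cnt) :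
    partP (m + 1) k cnt s v u = (1 / (m : ℝ)) * ∑ i : Fin m,
      (swapProb s i v * (if u = edgeSwap i v then 1 else 0)
        + (1 - swapProb s i v) * (if u = v then 1 else 0)) := by
  have hm : ((m + 1 : ℕ) : ℝ) - 1 = m := by push_cast; ring
  rw [partP, hm, Fin.sum_sum_ite_eq_add_one (fun i j =>
      if v.1 i = v.1 j then (if u = v then 1 else 0)
      else
        (s (v.1 i) / (s (v.1 i) + s (v.1 j))) *
          (if u.1 = v.1 ∘ Equiv.swap i j then 1 else 0)
        + (s (v.1 j) / (s (v.1 i) + s (v.1 j))) *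
          (if u = v then 1 else 0))]
  congr 1
  refine Finset.sum_congr rfl fun i _ => ?_
  by_cases h : v.1 i.castSucc = v.1 i.succ
  · rw [if_pos h, edgeSwap_eq_self h]
    ring
  · rw [if_neg h]
    have h1 := hs (v.1 i.castSucc)
    have h2 := hs (v.1 i.succ)
    have e1 : 1 - swapProb s i v =
        s (v.1 i.succ) / (s (v.1 i.castSucc) + s (v.1 i.succ)) := by
      rw [swapProb]; field_simp; ring
    have e2 : (u.1 = v.1 ∘ Equiv.swap i.castSucc i.succ) ↔ u = edgeSwap i v :=
      (Subtype.ext_iff (a1 := u) (a2 := edgeSwap i v)).symm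
    simp only [e1, e2]
    rfl

theorem sum_partP_mul {m k : ℕ} {cnt : Fin k → ℕ} {s : Fin k → ℝ} (hs : ∀ j, 0 < s j)
    (f : PSpace (m + 1) k cnt → ℝ) (v : PSpace (m + 1) k cnt) :
    ∑ u, partP (m + 1) k cnt s v u * f u = (1 / (m : ℝ)) * ∑ i : Fin m,
      (swapProb s i v * f (edgeSwap i v) + (1 - swapProb s i v) * f v) := by
  simp only [partP_apply hs, mul_assoc, ← Finset.mul_sum, Finset.sum_mul]
  rw [Finset.sum_comm]
  congr 1
  refine Finset.sum_congr rfl fun i _ => ?_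
  simp only [add_mul, Finset.sum_add_distrib, mul_assoc, ← Finset.mul_sum, ite_mul, one_mul,
    zero_mul, Finset.sum_ite_eq', Finset.mem_univ, if_true]

theorem partW_mul_partP {m k : ℕ} {cnt : Fin k → ℕ} {s : Fin k → ℝ} (hs : ∀ j, 0 < s j)
    (u v : PSpace (m + 1) k cnt) :
    partW (m + 1) k cnt s u * partP (m + 1) k cnt s u v =
      partW (m + 1) k cnt s v * partP (m + 1) k cnt s v u := by
  simp only [partP_apply hs]
  rw [mul_left_comm, mul_left_comm (partW (m + 1) k cnt s v)]
  refine congrArg _ ?_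
  rw [Finset.mul_sum, Finset.mul_sum]
  refine Finset.sum_congr rfl fun i _ => ?_
  rcases eq_or_ne u v with rfl | huv
  · rfl
  · simp only [if_neg huv, if_neg huv.symm, mul_zero, add_zero]
    by_cases h : v = edgeSwap i u
    · have h' : u = edgeSwap i v := by rw [h, edgeSwap_involutive i u]
      rw [if_pos h, if_pos h', mul_one, mul_one, partW_mul_swapProb hs i u, ← h]
    · have h' : u ≠ edgeSwap i v := fun h' => h (by rw [h', edgeSwap_involutive i v])
      rw [if_neg h, if_neg h']
      ring

/-- A binary word `p` has a descent at `i` if `p` holds at `i` and fails at `i + 1`. -/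
def IsDescent {m : ℕ} (p : Fin (m + 1) → Prop) (i : Fin m) : Prop :=
  p i.castSucc ∧ ¬ p i.succ

/-- The leftmost descent of a binary word. -/
def IsFirstDescent {m : ℕ} (p : Fin (m + 1) → Prop) (i : Fin m) : Prop :=
  IsDescent p i ∧ ∀ j < i, ¬ IsDescent p j

theorem exists_isFirstDescent {m : ℕ} {p : Fin (m + 1) → Prop} {i : Fin m}
    (h : IsDescent p i) : ∃ j, IsFirstDescent p j := by
  obtain ⟨j, hj, hmin⟩ := WellFounded.has_min (wellFounded_lt (α := Fin m))
    {i | IsDescent p i} ⟨i, h⟩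
  exact ⟨j, hj, fun l hl hl' => hmin l hl' hl⟩

theorem isFirstDescent_comp_swap {m : ℕ} {p : Fin (m + 1) → Prop} {i : Fin m}
    (h : IsFirstDescent (p ∘ Equiv.swap i.castSucc i.succ) i) :
    ¬ p i.castSucc ∧ p i.succ ∧ ∀ j : Fin m, (j : ℕ) + 1 < i → p j.castSucc → p j.succ := by
  obtain ⟨⟨h1, h2⟩, h3⟩ := h
  simp only [Function.comp_apply, Equiv.swap_apply_left, Equiv.swap_apply_right] at h1 h2
  refine ⟨h2, h1, fun j hj hpj => ?_⟩
  by_contra hns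
  refine h3 j (Fin.lt_def.2 (by omega)) ⟨?_, ?_⟩
  · rw [Function.comp_apply, Equiv.swap_apply_of_ne_of_ne] <;>
      simp [Fin.ext_iff, hpj] <;> omega
  · rw [Function.comp_apply, Equiv.swap_apply_of_ne_of_ne] <;>
      simp [Fin.ext_iff, hns] <;> omega

theorem not_three_isFirstDescent_comp_swap {m : ℕ} {p : Fin (m + 1) → Prop} {a b c : Fin m}
    (hab : a < b) (hbc : b < c)
    (ha : IsFirstDescent (p ∘ Equiv.swap a.castSucc a.succ) a)
    (hb : IsFirstDescent (p ∘ Equiv.swap b.castSucc b.succ) b)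
    (hc : IsFirstDescent (p ∘ Equiv.swap c.castSucc c.succ) c) : False := by
  obtain ⟨-, ha2, -⟩ := isFirstDescent_comp_swap ha
  obtain ⟨hb1, hb2, -⟩ := isFirstDescent_comp_swap hb
  obtain ⟨hc1, -, hc3⟩ := isFirstDescent_comp_swap hc
  have hprop : ∀ d : ℕ, ∀ h : (a : ℕ) + 1 + d < m + 1, (a : ℕ) + 1 + d < c →
      p ⟨(a : ℕ) + 1 + d, h⟩ := by
    intro d
    induction d with
    | zero => intro _ _; exact ha2
    | succ d ih =>
      intro h hd
      exact hc3 ⟨(a : ℕ) + 1 + d, by omega⟩ (by simp; omega) (ih (by omega) (by omega))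
  apply hb1
  have hab' := Fin.lt_def.1 hab
  have hbc' := Fin.lt_def.1 hbc
  have := hprop ((b : ℕ) - (a + 1)) (by have := b.2; omega) (by omega)
  convert this using 1
  exact Fin.ext (by simp; omega)

open Classical in
theorem card_isFirstDescent_comp_swap_le {m : ℕ} (p : Fin (m + 1) → Prop) :
    (univ.filter fun i : Fin m =>
      IsFirstDescent (p ∘ Equiv.swap i.castSucc i.succ) i).card ≤ 2 := by
  by_contra! hcard
  obtain ⟨a, b, c, ha, hb, hc, hab, hac, hbc⟩ := Finset.two_lt_card_iff.1 hcard
  simp only [Finset.mem_filter, Finset.mem_univ, true_and] at ha hb hc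
  rcases lt_or_gt_of_ne hab with h1 | h1 <;> rcases lt_or_gt_of_ne hac with h2 | h2 <;>
    rcases lt_or_gt_of_ne hbc with h3 | h3
  · exact not_three_isFirstDescent_comp_swap h1 h3 ha hb hc
  · exact not_three_isFirstDescent_comp_swap h2 h3 ha hc hb
  · exact absurd (h1.trans h3) h2.asymm
  · exact not_three_isFirstDescent_comp_swap h2 h1 hc ha hb
  · exact not_three_isFirstDescent_comp_swap h1 h2 hb ha hc
  · exact absurd (h3.trans h1) h2.asymm
  · exact not_three_isFirstDescent_comp_swap h3 h2 hb hc ha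
  · exact not_three_isFirstDescent_comp_swap h3 h1 hc hb ha

/-- Words with the same letter counts and no descent coincide. -/
theorem PSpace.eq_of_monotone {n k : ℕ} {cnt : Fin k → ℕ} {v v' : PSpace n k cnt}
    (h : Monotone v.1) (h' : Monotone v'.1) : v = v' := by
  have e : ∀ j, Nonempty ({i // v.1 i = j} ≃ {i // v'.1 i = j}) := fun j =>
    Fintype.card_eq.1 (by rw [Fintype.card_subtype, Fintype.card_subtype, v.2, v'.2])
  let τ : Fin n ≃ Fin n := Equiv.ofFiberEquiv fun j => (e j).some
  have hτ : v'.1 ∘ τ = v.1 := funext fun i => Equiv.ofFiberEquiv_map _ i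
  apply Subtype.ext
  have := Tuple.unique_monotone (f := v'.1) (σ := τ) (τ := Equiv.refl _)
    (by rwa [hτ]) (by simpa using h')
  rw [← hτ, this]
  rfl

/-- The sorting move: fix the leftmost descent from the strongest letter `2` to a weaker one,
or, if all letters `2` are already at the end, the leftmost descent to the weakest letter `0`. -/
def IsSortMove {m : ℕ} {cnt : Fin 3 → ℕ} (v : PSpace (m + 1) 3 cnt) (i : Fin m) : Prop :=
  IsFirstDescent (fun k => v.1 k = 2) i ∨
    ((∀ j, ¬ IsDescent (fun k => v.1 k = 2) j) ∧ IsFirstDescent (fun k => v.1 k ≠ 0) i)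

theorem PSpace.eq_of_no_sortMove {m : ℕ} {cnt : Fin 3 → ℕ} {v v' : PSpace (m + 1) 3 cnt}
    (h : ∀ i, ¬ IsSortMove v i) (h' : ∀ i, ¬ IsSortMove v' i) : v = v' := by
  have key : ∀ u : PSpace (m + 1) 3 cnt, (∀ i, ¬ IsSortMove u i) → Monotone u.1 := by
    intro u hu
    have h2 : ∀ j, ¬ IsDescent (fun k => u.1 k = 2) j := fun j hj => by
      obtain ⟨i, hi⟩ := exists_isFirstDescent hj
      exact hu i (Or.inl hi)
    have h0 : ∀ j, ¬ IsDescent (fun k => u.1 k ≠ 0) j := fun j hj => by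
      obtain ⟨i, hi⟩ := exists_isFirstDescent hj
      exact hu i (Or.inr ⟨h2, hi⟩)
    refine Fin.monotone_iff_le_succ.2 fun j => ?_
    have h2j := h2 j
    have h0j := h0 j
    simp only [IsDescent] at h2j h0j
    generalize u.1 j.castSucc = x at *
    generalize u.1 j.succ = y at *
    revert x y
    decide
  exact PSpace.eq_of_monotone (key v h) (key v' h')

theorem half_le_swapProb_of_isSortMove {m : ℕ} {cnt : Fin 3 → ℕ} {s : Fin 3 → ℝ}
    (hs : ∀ j, 0 < s j) (h01 : s 0 ≤ s 1) (h12 : s 1 ≤ s 2) {v : PSpace (m + 1) 3 cnt}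
    {i : Fin m} (h : IsSortMove v i) : 1 / 2 ≤ swapProb s i v := by
  have hle : s (v.1 i.succ) ≤ s (v.1 i.castSucc) := by
    rcases h with ⟨⟨h1, -⟩, -⟩ | ⟨-, ⟨-, h2⟩, -⟩
    · generalize v.1 i.succ = y
      rw [h1]
      fin_cases y
      · exact h01.trans h12
      · exact h12
      · exact le_rfl
    · simp only [not_not] at h2
      rw [h2]
      generalize v.1 i.castSucc = y
      fin_cases y
      · exact le_rfl
      · exact h01
      · exact h01.trans h12
  have h1 := hs (v.1 i.castSucc)
  have h2 := hs (v.1 i.succ)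
  rw [swapProb, div_le_div_iff₀ two_pos (by linarith)]
  linarith

open Classical in
/-- The Lyapunov weight of a word: `1` while some letter `2` is out of place, and `M` after. -/
noncomputable def sortWeight {m : ℕ} {cnt : Fin 3 → ℕ} (M : ℝ) (v : PSpace (m + 1) 3 cnt) : ℝ :=
  if ∃ j, IsDescent (fun k => v.1 k = 2) j then 1 else M

open Classical in
theorem sum_isFirstDescent_edgeSwap_le {m : ℕ} {cnt : Fin 3 → ℕ} {s : Fin 3 → ℝ}
    (hs : ∀ j, 0 < s j) {r : ℝ} (q : Fin 3 → Prop)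
    (hq : ∀ x y, ¬ q x → q y → 2 * s x ≤ r * s y) (v : PSpace (m + 1) 3 cnt) :
    ∑ i : Fin m, (if IsFirstDescent (fun k => q ((edgeSwap i v).1 k)) i
      then partW (m + 1) 3 cnt s (edgeSwap i v) else 0) ≤
      |r| * partW (m + 1) 3 cnt s v := by
  have hterm : ∀ i : Fin m, IsFirstDescent (fun k => q ((edgeSwap i v).1 k)) i →
      partW (m + 1) 3 cnt s (edgeSwap i v) ≤ |r| / 2 * partW (m + 1) 3 cnt s v := by
    intro i hi
    obtain ⟨h1, h2⟩ := hi.1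
    simp only [edgeSwap_castSucc, edgeSwap_succ] at h1 h2
    have h3 := hq _ _ h2 h1
    have h4 := partW_edgeSwap s i v
    have hb := hs (v.1 i.succ)
    have hw := partW_pos hs v
    have h5 : r * s (v.1 i.succ) ≤ |r| * s (v.1 i.succ) := by gcongr; exact le_abs_self r
    refine le_of_mul_le_mul_right ?_ hb
    rw [h4]
    nlinarith
  rw [← Finset.sum_filter]
  have hcard : ((univ.filter fun i : Fin m =>
      IsFirstDescent (fun k => q ((edgeSwap i v).1 k)) i).card : ℝ) ≤ 2 := by
    exact_mod_cast card_isFirstDescent_comp_swap_le fun k => q (v.1 k)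
  have hw := partW_pos hs v
  calc _ ≤ ∑ _i ∈ univ.filter fun i : Fin m =>
        IsFirstDescent (fun k => q ((edgeSwap i v).1 k)) i,
          |r| / 2 * partW (m + 1) 3 cnt s v :=
        Finset.sum_le_sum fun i hi => hterm i (Finset.mem_filter.1 hi).2
    _ ≤ 2 * (|r| / 2 * partW (m + 1) 3 cnt s v) := by
        rw [Finset.sum_const, nsmul_eq_mul]
        gcongr
    _ = _ := by ring

theorem no_isDescent_of_edgeSwap {m : ℕ} {cnt : Fin 3 → ℕ} {v : PSpace (m + 1) 3 cnt} {i : Fin m}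
    (h2 : ∀ j, ¬ IsDescent (fun k => (edgeSwap i v).1 k = 2) j)
    (h0 : IsDescent (fun k => (edgeSwap i v).1 k ≠ 0) i) :
    ∀ j, ¬ IsDescent (fun k => v.1 k = 2) j := by
  have hi := h2 i
  obtain ⟨h3, h4⟩ := h0
  simp only [IsDescent, edgeSwap_castSucc, edgeSwap_succ, not_not] at hi h3 h4
  have h5 : v.1 i.succ ≠ 2 := fun h => hi ⟨h, by rw [h4]; decide⟩
  have h6 : v.1 i.castSucc ≠ 2 := by rw [h4]; decide
  have e : (fun k => (edgeSwap i v).1 k = 2) = fun k => v.1 k = 2 := by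
    funext k
    simp only [edgeSwap, Function.comp_apply, Equiv.swap_apply_def, eq_iff_iff]
    split_ifs with ha hb
    · subst ha; simp [h5, h6]
    · subst hb; simp [h5, h6]
    · rfl
  rwa [e] at h2

open Classical in
theorem sum_isSortMove_edgeSwap_le {m : ℕ} {cnt : Fin 3 → ℕ} {s : Fin 3 → ℝ}
    (hs : ∀ j, 0 < s j) {r : ℝ} (hr0 : 0 < r) (hr1 : r < 1) (h01 : 2 * s 0 ≤ r * s 1)
    (h12 : 2 * s 1 ≤ r * s 2) (v : PSpace (m + 1) 3 cnt) :
    ∑ i : Fin m, (if IsSortMove (edgeSwap i v) i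
      then partW (m + 1) 3 cnt s (edgeSwap i v) * sortWeight (2 / (1 - r)) (edgeSwap i v)
      else 0) ≤ (1 + r) / 2 * (partW (m + 1) 3 cnt s v * sortWeight (2 / (1 - r)) v) := by
  have hs0 := hs 0
  have hs1 := hs 1
  have hs2 := hs 2
  have h1r : 0 < 1 - r := by linarith
  set M : ℝ := 2 / (1 - r) with hM
  have hM0 : 0 < M := by positivity
  have hMr : (1 - r) * M = 2 := by rw [hM]; field_simp
  set w := partW (m + 1) 3 cnt s with hw
  have hwv := partW_pos hs v
  have h02 : 2 * s 0 ≤ r * s 2 := by nlinarith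
  have hsum2 := sum_isFirstDescent_edgeSwap_le hs (r := r) (fun x => x = 2) (by
    intro x y hx hy
    subst hy
    fin_cases x
    · exact h02
    · exact h12
    · exact absurd rfl hx) v
  have hsum0 := sum_isFirstDescent_edgeSwap_le hs (r := r) (fun x => x ≠ 0) (by
    intro x y hx hy
    rw [not_not] at hx
    subst hx
    fin_cases y
    · exact absurd rfl hy
    · exact h01
    · exact h02) v
  rw [abs_of_pos hr0] at hsum2 hsum0
  have hterm : ∀ i : Fin m, (if IsSortMove (edgeSwap i v) i
      then w (edgeSwap i v) * sortWeight M (edgeSwap i v) else 0) ≤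
      (if IsFirstDescent (fun k => (edgeSwap i v).1 k = 2) i then w (edgeSwap i v) else 0) +
      (if ∃ j, IsDescent (fun k => v.1 k = 2) j then 0 else M) *
      (if IsFirstDescent (fun k => (edgeSwap i v).1 k ≠ 0) i then w (edgeSwap i v) else 0) := by
    intro i
    have hwi : 0 < w (edgeSwap i v) := partW_pos hs _
    have hnn : 0 ≤ (if ∃ j, IsDescent (fun k => v.1 k = 2) j then 0 else M) *
      (if IsFirstDescent (fun k => (edgeSwap i v).1 k ≠ 0) i then w (edgeSwap i v) else 0) := by
      split_ifs <;> positivity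
    by_cases hA : IsFirstDescent (fun k => (edgeSwap i v).1 k = 2) i
    · have hA' : IsSortMove (edgeSwap i v) i := Or.inl hA
      rw [if_pos hA', if_pos hA, sortWeight, if_pos ⟨i, hA.1⟩]
      linarith
    · rw [if_neg hA]
      by_cases hB : IsSortMove (edgeSwap i v) i
      · obtain ⟨hB1, hB2⟩ := hB.resolve_left hA
        have hB3 := no_isDescent_of_edgeSwap hB1 hB2.1
        rw [if_pos hB, if_pos hB2, sortWeight, if_neg (not_exists.2 hB1),
          if_neg (not_exists.2 hB3)]
        linarith
      · rw [if_neg hB]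
        linarith
  refine (Finset.sum_le_sum fun i _ => hterm i).trans ?_
  rw [Finset.sum_add_distrib, ← Finset.mul_sum, sortWeight]
  split_ifs with hv
  · rw [zero_mul, mul_one, add_zero]
    refine hsum2.trans ?_
    gcongr
    linarith
  · have := mul_le_mul_of_nonneg_left hsum0 hM0.le
    have e : (1 + r) / 2 * (w v * M) = r * w v + M * (r * w v) + (1 - r) * w v := by
      linear_combination (w v) / 2 * hMr
    nlinarith [mul_pos h1r hwv]

/-- A Poincaré constant per edge, for strength ratios at most `r / 2`. -/
noncomputable def poincareConst (r : ℝ) : ℝ :=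
  2 * (2 * (1 + (1 + r) / 2) * (2 / (1 - r)) / (1 - (1 + r) / 2) ^ 2)

theorem poincareConst_pos {r : ℝ} (hr0 : 0 < r) (hr1 : r < 1) : 0 < poincareConst r := by
  have h1 : 0 < 1 - r := by linarith
  have h2 : 0 < 1 - (1 + r) / 2 := by linarith
  rw [poincareConst]
  positivity

open Classical in
theorem sum_partW_mul_sq_le {m : ℕ} {cnt : Fin 3 → ℕ} {s : Fin 3 → ℝ}
    (hs : ∀ j, 0 < s j) {r : ℝ} (hr0 : 0 < r) (hr1 : r < 1) (h01 : 2 * s 0 ≤ r * s 1)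
    (h12 : 2 * s 1 ≤ r * s 2) (f : PSpace (m + 1) 3 cnt → ℝ)
    (hf : ∑ v, partW (m + 1) 3 cnt s v * f v = 0) :
    ∑ v, partW (m + 1) 3 cnt s v * f v ^ 2 ≤ poincareConst r * ∑ i : Fin m, ∑ v,
      partW (m + 1) 3 cnt s v * swapProb s i v * (f v - f (edgeSwap i v)) ^ 2 := by
  have h1r : 0 < 1 - r := by linarith
  have hM : 1 ≤ 2 / (1 - r) := by rw [le_div_iff₀ h1r]; linarith
  rcases isEmpty_or_nonempty (PSpace (m + 1) 3 cnt) with hE | ⟨⟨v₀⟩⟩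
  · simp
  obtain ⟨x₀, hx₀⟩ : ∃ x₀ : PSpace (m + 1) 3 cnt, ∀ v, v ≠ x₀ → ∃ i, IsSortMove v i := by
    by_cases h : ∃ x₀ : PSpace (m + 1) 3 cnt, ∀ i, ¬ IsSortMove x₀ i
    · obtain ⟨x₀, hx₀⟩ := h
      refine ⟨x₀, fun v hv => ?_⟩
      by_contra! hcon
      exact hv (PSpace.eq_of_no_sortMove hcon hx₀)
    · push Not at h
      exact ⟨v₀, fun v _ => h v⟩
  have h := sum_sq_le_of_subcritical (σ := fun i : Fin m => edgeSwap i)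
    (fun i => edgeSwap_involutive i) IsSortMove (partW_pos hs)
    (h := sortWeight (2 / (1 - r))) (M := 2 / (1 - r)) (r := (1 + r) / 2)
    (by linarith) (by linarith)
    (fun v => by rw [sortWeight]; split_ifs; exacts [le_rfl, hM])
    (fun v => by rw [sortWeight]; split_ifs; exacts [hM, le_rfl])
    (sum_isSortMove_edgeSwap_le hs hr0 hr1 h01 h12) x₀ hx₀ f hf
  refine h.trans ?_
  have hle : ∑ i : Fin m, ∑ v, (if IsSortMove v i then
      partW (m + 1) 3 cnt s v * (f v - f (edgeSwap i v)) ^ 2 else 0) ≤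
      2 * ∑ i : Fin m, ∑ v,
        partW (m + 1) 3 cnt s v * swapProb s i v * (f v - f (edgeSwap i v)) ^ 2 := by
    rw [Finset.mul_sum]
    refine Finset.sum_le_sum fun i _ => ?_
    rw [Finset.mul_sum]
    refine Finset.sum_le_sum fun v _ => ?_
    have hwv := partW_pos hs v
    have hA : 0 ≤ partW (m + 1) 3 cnt s v * (f v - f (edgeSwap i v)) ^ 2 := by positivity
    split_ifs with hv
    · have hs0 := hs 0
      have hs1 := hs 1
      have hs2 := hs 2
      have := half_le_swapProb_of_isSortMove hs (by nlinarith) (by nlinarith) hv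
      nlinarith
    · have h1 := hs (v.1 i.castSucc)
      have h2 := hs (v.1 i.succ)
      have : 0 ≤ swapProb s i v := by rw [swapProb]; positivity
      positivity
  have hc : 0 ≤ poincareConst r / 2 := by have := poincareConst_pos hr0 hr1; positivity
  calc _ = poincareConst r / 2 * ∑ i : Fin m, ∑ v, (if IsSortMove v i then
      partW (m + 1) 3 cnt s v * (f v - f (edgeSwap i v)) ^ 2 else 0) := by
        rw [poincareConst]; congr 1; ring
    _ ≤ _ := mul_le_mul_of_nonneg_left hle hc
    _ = _ := by ring

theorem partW_le_mul_partW {n k : ℕ} {cnt : Fin k → ℕ} {s : Fin k → ℝ} (hs : ∀ j, 0 < s j)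
    {κ : ℝ} (hκ1 : 1 ≤ κ) (hκ : ∀ i j, s i ≤ κ * s j) (u v : PSpace n k cnt) :
    partW n k cnt s u ≤ κ ^ (n ^ 2) * partW n k cnt s v := by
  have e : κ ^ (n ^ 2) = ∏ _i : Fin n, κ ^ n := by
    rw [Finset.prod_const, Finset.card_univ, Fintype.card_fin, ← pow_mul, sq]
  rw [e, partW, partW, ← Finset.prod_mul_distrib]
  refine Finset.prod_le_prod (fun i _ => (pow_pos (hs _) _).le) fun i _ => ?_
  calc s (u.1 i) ^ ((i : ℕ) + 1) ≤ (κ * s (v.1 i)) ^ ((i : ℕ) + 1) :=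
        pow_le_pow_left₀ (hs _).le (hκ _ _) _
    _ = κ ^ ((i : ℕ) + 1) * s (v.1 i) ^ ((i : ℕ) + 1) := mul_pow _ _ _
    _ ≤ _ := by
        have := hs (v.1 i)
        gcongr
        exact i.2

theorem sum_partW_pos {n k : ℕ} {cnt : Fin k → ℕ} {s : Fin k → ℝ} (hs : ∀ j, 0 < s j)
    (x : PSpace n k cnt) : 0 < ∑ u, partW n k cnt s u :=
  Finset.sum_pos (fun u _ => partW_pos hs u) ⟨x, Finset.mem_univ x⟩

theorem sum_partPi {n k : ℕ} {cnt : Fin k → ℕ} {s : Fin k → ℝ} (hs : ∀ j, 0 < s j)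
    (x : PSpace n k cnt) : ∑ u, partPi n k cnt s u = 1 := by
  simp only [partPi, ← Finset.sum_div]
  exact div_self (sum_partW_pos hs x).ne'

theorem one_div_partPi_le {n k : ℕ} {cnt : Fin k → ℕ} {s : Fin k → ℝ} (hs : ∀ j, 0 < s j)
    {κ : ℝ} (hκ1 : 1 ≤ κ) (hκ : ∀ i j, s i ≤ κ * s j) (x : PSpace n k cnt) :
    1 / partPi n k cnt s x ≤ (k : ℝ) ^ n * κ ^ (n ^ 2) := by
  have hx := partW_pos hs x
  rw [partPi, one_div_div, div_le_iff₀ hx]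
  have hcard : (Fintype.card (PSpace n k cnt) : ℝ) ≤ (k : ℝ) ^ n := by
    have := Fintype.card_subtype_le
      (fun w : Fin n → Fin k => ∀ j : Fin k, (Finset.univ.filter fun i => w i = j).card = cnt j)
    rw [Fintype.card_fun, Fintype.card_fin, Fintype.card_fin] at this
    exact_mod_cast this
  calc ∑ u, partW n k cnt s u ≤ ∑ _u : PSpace n k cnt, κ ^ (n ^ 2) * partW n k cnt s x :=
        Finset.sum_le_sum fun u _ => partW_le_mul_partW hs hκ1 hκ u x
    _ = Fintype.card (PSpace n k cnt) * (κ ^ (n ^ 2) * partW n k cnt s x) := by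
        rw [Finset.sum_const, Finset.card_univ, nsmul_eq_mul]
    _ ≤ (k : ℝ) ^ n * (κ ^ (n ^ 2) * partW n k cnt s x) := by gcongr
    _ = _ := by ring

/-- A word of length at most one leaves no edge to update, the transition matrix vanishes, and
no power of it is close to stationarity. -/
theorem mixingTime_partP_of_le_one {n k : ℕ} (hn : n ≤ 1) {cnt : Fin k → ℕ} {s : Fin k → ℝ}
    (hs : ∀ j, 0 < s j) : mixingTime (partP n k cnt s) (partPi n k cnt s) = 0 := by
  have hP : partP n k cnt s = 0 := by
    funext v u
    rw [partP, Finset.sum_eq_zero, mul_zero, Matrix.zero_apply]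
    intro i _
    refine Finset.sum_eq_zero fun j _ => if_neg ?_
    have := j.2
    omega
  rw [mixingTime, Nat.sInf_eq_zero]
  rcases isEmpty_or_nonempty (PSpace n k cnt) with hE | ⟨⟨x⟩⟩
  · exact Or.inl fun x => isEmptyElim x
  · refine Or.inr (Set.eq_empty_iff_forall_notMem.2 fun T hT => ?_)
    have h := hT x (T + 1) (Nat.le_succ T)
    have hZ := sum_partW_pos hs x
    simp only [hP, pow_succ, mul_zero, Matrix.zero_apply, zero_sub, abs_neg] at h
    have e : ∀ y, |partPi n k cnt s y| = partPi n k cnt s y := fun y =>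
      abs_of_nonneg (div_nonneg (partW_pos hs y).le hZ.le)
    simp only [e, sum_partPi hs x] at h
    norm_num at h

theorem mixingTime_partP_le {m : ℕ} (hm : 0 < m) {cnt : Fin 3 → ℕ} {s : Fin 3 → ℝ}
    (hs : ∀ j, 0 < s j) {r : ℝ} (hr0 : 0 < r) (hr1 : r < 1) (h01 : 2 * s 0 ≤ r * s 1)
    (h12 : 2 * s 1 ≤ r * s 2) {κ : ℝ} (hκ1 : 1 ≤ κ) (hκ : ∀ i j, s i ≤ κ * s j) {T : ℕ}
    (hT : 2 * poincareConst r * m * ((m + 1) ^ 2 * Real.log (3 * κ) + 2) ≤ T) :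
    mixingTime (partP (m + 1) 3 cnt s) (partPi (m + 1) 3 cnt s) ≤ T := by
  refine Nat.sInf_le fun x t ht => ?_
  have hΛ := poincareConst_pos hr0 hr1
  set Λ := poincareConst r with hΛdef
  have hZ := sum_partW_pos hs x
  have hm0 : (0 : ℝ) < m := by exact_mod_cast hm
  have : Nonempty (Fin m) := ⟨⟨0, hm⟩⟩
  refine half_sum_abs_pow_sub_le (π := partPi (m + 1) 3 cnt s) (γ := 1 / (2 * Λ * m))
    (fun v => div_pos (partW_pos hs v) hZ)
    (sum_partPi hs x) (fun u v => ?_) (fun v => ?_) (fun f hf => ?_) x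
    (one_div_partPi_le hs hκ1 hκ x) ?_
  · rw [partPi, partPi, div_mul_eq_mul_div, div_mul_eq_mul_div, partW_mul_partP hs]
  · have := sum_partP_mul hs (fun _ => 1) v
    simp only [mul_one] at this
    rw [this]
    simp
    field_simp
  · have e : ∀ g : PSpace (m + 1) 3 cnt → ℝ, ∑ v, partPi (m + 1) 3 cnt s v * g v =
        (∑ v, partW (m + 1) 3 cnt s v * g v) / ∑ u, partW (m + 1) 3 cnt s u := by
      intro g
      rw [Finset.sum_div]
      exact Finset.sum_congr rfl fun v _ => by rw [partPi, div_mul_eq_mul_div]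
    rw [e, div_eq_zero_iff, or_iff_left hZ.ne'] at hf
    rw [e, e, ← mul_div_assoc]
    simp only [sum_partP_mul hs]
    have := sum_sq_average_heatBath_le (σ := fun i : Fin m => edgeSwap (cnt := cnt) i)
      (fun i => edgeSwap_involutive i) (partW_pos hs) (swapProb_edgeSwap hs)
      (partW_mul_swapProb hs) hΛ f (sum_partW_mul_sq_le hs hr0 hr1 h01 h12 f hf)
    rw [Fintype.card_fin] at this
    gcongr
  · have h3 : (3 : ℝ) * κ = Real.exp (Real.log (3 * κ)) := (Real.exp_log (by positivity)).symm
    have hB : ((3 : ℕ) : ℝ) ^ (m + 1) * κ ^ ((m + 1) ^ 2) ≤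
        Real.exp ((m + 1) ^ 2 * Real.log (3 * κ)) := by
      calc ((3 : ℕ) : ℝ) ^ (m + 1) * κ ^ ((m + 1) ^ 2)
          ≤ 3 ^ ((m + 1) ^ 2) * κ ^ ((m + 1) ^ 2) := by
            push_cast
            gcongr
            · norm_num
            · nlinarith
        _ = (3 * κ) ^ ((m + 1) ^ 2) := (mul_pow _ _ _).symm
        _ = _ := by
            conv_lhs => rw [h3]
            rw [← Real.exp_nat_mul]
            push_cast
            rfl
    have hexp : (m + 1 : ℝ) ^ 2 * Real.log (3 * κ) + -(1 / (2 * Λ * m)) * t ≤ -2 := by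
      have htT : (T : ℝ) ≤ t := by exact_mod_cast ht
      have : (m + 1 : ℝ) ^ 2 * Real.log (3 * κ) + 2 ≤ 1 / (2 * Λ * m) * t := by
        rw [div_mul_eq_mul_div, one_mul, le_div_iff₀ (by positivity)]
        linarith
      linarith
    calc _ ≤ Real.exp ((m + 1) ^ 2 * Real.log (3 * κ)) * Real.exp (-(1 / (2 * Λ * m)) * t) := by
          gcongr
      _ ≤ Real.exp (-2) := by rw [← Real.exp_add]; exact Real.exp_le_exp.2 hexp
      _ ≤ 1 / 4 := by
          have h1 : (2 : ℝ) ≤ Real.exp 1 := by linarith [Real.add_one_le_exp (1 : ℝ)]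
          have h2 : (4 : ℝ) ≤ Real.exp 2 := by
            have : Real.exp 2 = Real.exp 1 * Real.exp 1 := by rw [← Real.exp_add]; norm_num
            nlinarith
          rw [Real.exp_neg, ← one_div]
          exact one_div_le_one_div_of_le (by norm_num) h2

/-- For the three-type linear particle system `X₃(n)` on `Ω_{a,b,c}`
with strengths `0 < s_A < s_B < s_C` such that `s_A/s_B < 1/2` and `s_B/s_C < 1/2`,
there is a constant `C` depending only on the ratios `s_A/s_B` and `s_B/s_C`
(and not on `n, a, b, c`) with `t(X₃(n)) ≤ C·n¹⁰`. -/
theorem particle_three_types_mixing (qAB qBC : ℝ) :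
    ∃ C : ℝ, 0 < C ∧
      ∀ (a b c : ℕ) (sA sB sC : ℝ),
        0 < sA → sA < sB → sB < sC →
        sA / sB = qAB → sB / sC = qBC → qAB < 1 / 2 → qBC < 1 / 2 →
        (mixingTime (partP (a + b + c) 3 ![a, b, c] ![sA, sB, sC])
            (partPi (a + b + c) 3 ![a, b, c] ![sA, sB, sC]) : ℝ) ≤
          C * ((a + b + c : ℕ) : ℝ) ^ 10 := by
  by_cases hq : 0 < qAB ∧ qAB < 1 / 2 ∧ 0 < qBC ∧ qBC < 1 / 2
  swap
  · refine ⟨1, one_pos, fun a b c sA sB sC hA hAB hBC e1 e2 h1 h2 => absurd ?_ hq⟩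
    have hB := hA.trans hAB
    exact ⟨e1 ▸ div_pos hA hB, h1, e2 ▸ div_pos hB (hB.trans hBC), h2⟩
  obtain ⟨hq1, hq1', hq2, hq2'⟩ := hq
  set r : ℝ := max (2 * qAB) (2 * qBC) with hr
  have hr0 : 0 < r := lt_max_of_lt_left (by linarith)
  have hr1 : r < 1 := max_lt (by linarith) (by linarith)
  set κ : ℝ := 1 / (qAB * qBC) with hκ
  have hκ1 : 1 ≤ κ := by
    rw [hκ, le_div_iff₀ (by positivity)]
    nlinarith
  have hΛ := poincareConst_pos hr0 hr1
  have hL : 0 ≤ Real.log (3 * κ) := Real.log_nonneg (by linarith)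
  set Λ := poincareConst r with hΛdef
  set L := Real.log (3 * κ) with hLdef
  refine ⟨2 * Λ * (L + 2) + 1, by positivity, ?_⟩
  intro a b c sA sB sC hA hAB hBC e1 e2 _ _
  have hB := hA.trans hAB
  have hC := hB.trans hBC
  have hs : ∀ j, 0 < (![sA, sB, sC] : Fin 3 → ℝ) j := by
    intro j
    fin_cases j
    exacts [hA, hB, hC]
  generalize ![a, b, c] = cnt
  generalize a + b + c = n
  rcases Nat.lt_or_ge 1 n with hn | hn
  swap
  · rw [mixingTime_partP_of_le_one hn hs, Nat.cast_zero]
    positivity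
  obtain ⟨m, rfl⟩ : ∃ m, n = m + 1 := ⟨n - 1, by omega⟩
  have eA : sA = qAB * sB := by rw [← e1]; field_simp
  have eB : sB = qBC * sC := by rw [← e2]; field_simp
  have eC : sC = κ * sA := by rw [eA, eB, hκ]; field_simp
  have h01 : 2 * sA ≤ r * sB := by
    rw [eA, ← mul_assoc]
    gcongr
    exact le_max_left _ _
  have h12 : 2 * sB ≤ r * sC := by
    rw [eB, ← mul_assoc]
    gcongr
    exact le_max_right _ _
  have hsC : ∀ j, (![sA, sB, sC] : Fin 3 → ℝ) j ≤ sC := by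
    intro j
    fin_cases j
    exacts [(hAB.trans hBC).le, hBC.le, le_rfl]
  have hsA : ∀ j, sA ≤ (![sA, sB, sC] : Fin 3 → ℝ) j := by
    intro j
    fin_cases j
    exacts [le_rfl, hAB.le, (hAB.trans hBC).le]
  have hκs : ∀ i j, (![sA, sB, sC] : Fin 3 → ℝ) i ≤ κ * (![sA, sB, sC] : Fin 3 → ℝ) j := by
    intro i j
    refine (hsC i).trans ?_
    refine eC.le.trans ?_
    exact mul_le_mul_of_nonneg_left (hsA j) (by linarith)
  have hmix := mixingTime_partP_le (by omega : 0 < m) (cnt := cnt) hs hr0 hr1 h01 h12 hκ1 hκs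
    (Nat.le_ceil _)
  have hx0 : 0 ≤ 2 * Λ * m * (((m : ℝ) + 1) ^ 2 * L + 2) := by positivity
  have hceil := Nat.ceil_lt_add_one hx0
  have hN1 : (1 : ℝ) ≤ (m : ℝ) + 1 := by linarith [(Nat.cast_nonneg m : (0 : ℝ) ≤ m)]
  push_cast
  set N : ℝ := (m : ℝ) + 1 with hN
  have hN3 : (1 : ℝ) ≤ N ^ 3 := one_le_pow₀ hN1
  have hN2 : (1 : ℝ) ≤ N ^ 2 := one_le_pow₀ hN1
  calc _ ≤ 2 * Λ * m * (N ^ 2 * L + 2) + 1 := (Nat.cast_le.2 hmix).trans hceil.le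
    _ ≤ 2 * Λ * N * (N ^ 2 * L + N ^ 2 * 2) + N ^ 3 := by
        gcongr
        · linarith
        · linarith
    _ = (2 * Λ * (L + 2) + 1) * N ^ 3 := by ring
    _ ≤ (2 * Λ * (L + 2) + 1) * N ^ 10 := by
        gcongr
        norm_num
end

section
/- Let G_3(n) be the gladiator chain on S_n with three teams A, B, C whose strengths satisfy 0 < s_A < s_B < s_C, s_A/s_B < 1/2, and s_B/s_C < 1/2. Then there is a constant C, depending only on the ratios s_A/s_B and s_B/s_C (and not on n or the team sizes), such that the mixing time satisfies t(G_3(n)) ≤ C·n^{18}. -/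
open Finset

/-- Transition matrix of the gladiator chain `G_k(n)`: from state `σ`, a position
`i` with `i+1 < n` is chosen uniformly at random; with probability
`s(σ i)/(s(σ i)+s(σ (i+1)))` the two entries are swapped, and with the complementary
probability they stay. -/
noncomputable def gladP (n k : ℕ) (team : Fin n → Fin k) (s : Fin k → ℝ) :
    Matrix (Equiv.Perm (Fin n)) (Equiv.Perm (Fin n)) ℝ :=
  fun σ τ => (1 / ((n : ℝ) - 1)) * ∑ i : Fin n, ∑ j : Fin n,
    if (j : ℕ) = (i : ℕ) + 1 then
      (s (team (σ i)) / (s (team (σ i)) + s (team (σ j)))) *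
        (if τ = σ * Equiv.swap i j then 1 else 0)
      + (s (team (σ j)) / (s (team (σ i)) + s (team (σ j)))) *
        (if τ = σ then 1 else 0)
    else 0

/-- Unnormalized stationary weight of the gladiator chain:
`w(σ) = ∏_g s(g)^{σ⁻¹(g)}` (positions counted `1,…,n`). -/
noncomputable def gladW (n k : ℕ) (team : Fin n → Fin k) (s : Fin k → ℝ)
    (σ : Equiv.Perm (Fin n)) : ℝ :=
  ∏ g : Fin n, s (team g) ^ ((σ.symm g : ℕ) + 1)

/-- Stationary distribution of the gladiator chain. -/
noncomputable def gladPi (n k : ℕ) (team : Fin n → Fin k) (s : Fin k → ℝ)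
    (σ : Equiv.Perm (Fin n)) : ℝ :=
  gladW n k team s σ / ∑ τ : Equiv.Perm (Fin n), gladW n k team s τ


namespace Gladiator

section AbstractChain

variable {Ω : Type*} [Fintype Ω] [DecidableEq Ω]

/-- If `P` preserves constants and the mean under `π`, and contracts the second moment of centred
functions by the factor `ρ`, then `P ^ t` is close to `π` in total variation. -/
lemma sq_sum_abs_pow_sub_le (P : Matrix Ω Ω ℝ) (π : Ω → ℝ) (ρ : ℝ) (hρ : 0 ≤ ρ)
    (hπ : ∀ x, 0 < π x) (hsum : ∑ x, π x = 1)
    (hone : P.mulVec (fun _ => 1) = fun _ => 1)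
    (hmean : ∀ f : Ω → ℝ, ∑ x, π x * P.mulVec f x = ∑ x, π x * f x)
    (hdecay : ∀ f : Ω → ℝ, ∑ x, π x * f x = 0 →
      ∑ x, π x * P.mulVec f x ^ 2 ≤ ρ * ∑ x, π x * f x ^ 2) (x : Ω) (t : ℕ) :
    π x * (∑ y, |(P ^ t) x y - π y|) ^ 2 ≤ ρ ^ t := by
  have hpow : ∀ (f : Ω → ℝ), ∑ x, π x * f x = 0 → ∀ t : ℕ,
      ∑ x, π x * (P ^ t).mulVec f x = 0 ∧
      ∑ x, π x * (P ^ t).mulVec f x ^ 2 ≤ ρ ^ t * ∑ x, π x * f x ^ 2 := by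
    intro f hf t
    induction t with
    | zero => simp [hf]
    | succ t ih =>
      have e : (P ^ (t + 1)).mulVec f = P.mulVec ((P ^ t).mulVec f) := by
        rw [pow_succ', Matrix.mulVec_mulVec]
      rw [e]
      refine ⟨by rw [hmean]; exact ih.1, (hdecay _ ih.1).trans ?_⟩
      rw [pow_succ', mul_assoc]
      exact mul_le_mul_of_nonneg_left ih.2 hρ
  have hone' : ∀ t : ℕ, (P ^ t).mulVec (fun _ => 1) = fun _ => 1 := by
    intro t
    induction t with
    | zero => simp
    | succ t ih => rw [pow_succ', ← Matrix.mulVec_mulVec, ih, hone]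
  let g : Ω → ℝ := fun y => SignType.sign ((P ^ t) x y - π y)
  let c : ℝ := ∑ y, π y * g y
  have hg : ∀ y, g y ^ 2 ≤ 1 := by
    intro y
    rcases lt_trichotomy ((P ^ t) x y - π y) 0 with h | h | h <;> simp [g, h]
  have hc : ∑ y, π y * (g y - c) = 0 := by
    simp only [mul_sub, sum_sub_distrib, ← sum_mul, hsum]
    simp [c]
  have hvar : ∑ y, π y * (g y - c) ^ 2 ≤ 1 := by
    have e : ∑ y, π y * (g y - c) ^ 2 = ∑ y, π y * g y ^ 2 - c ^ 2 := by
      have : ∀ y, π y * (g y - c) ^ 2 = π y * g y ^ 2 - 2 * c * (π y * g y) + c ^ 2 * π y := by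
        intro y; ring
      simp only [this, sum_add_distrib, sum_sub_distrib, ← mul_sum, hsum]
      change _ - 2 * c * c + _ = _
      ring
    have : ∑ y, π y * g y ^ 2 ≤ ∑ y, π y :=
      sum_le_sum fun y _ => by nlinarith [hg y, hπ y]
    nlinarith [sq_nonneg c]
  have hval : (P ^ t).mulVec (fun y => g y - c) x = ∑ y, |(P ^ t) x y - π y| := by
    have h1 : ∑ y, (P ^ t) x y = 1 := by
      have := congrFun (hone' t) x
      simpa [Matrix.mulVec, dotProduct] using this
    have h2 : ∀ y, |(P ^ t) x y - π y| = (P ^ t) x y * g y - π y * g y := by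
      intro y
      rw [← sub_mul]
      exact (self_mul_sign _).symm
    simp only [Matrix.mulVec, dotProduct, mul_sub, sum_sub_distrib, ← sum_mul, h1, h2]
    simp [c]
  have hfin := (hpow _ hc t).2
  have hx : π x * (P ^ t).mulVec (fun y => g y - c) x ^ 2 ≤
      ∑ z, π z * (P ^ t).mulVec (fun y => g y - c) z ^ 2 :=
    single_le_sum (f := fun z => π z * (P ^ t).mulVec (fun y => g y - c) z ^ 2)
      (fun z _ => mul_nonneg (hπ z).le (sq_nonneg _)) (mem_univ x)
  rw [hval] at hx
  have := mul_le_mul_of_nonneg_left hvar (pow_nonneg hρ t)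
  linarith

end AbstractChain

section Chain

variable {m k : ℕ}

/-- The transposition of the positions `i` and `i + 1`. -/
def adj (i : Fin m) : Equiv.Perm (Fin (m + 1)) := Equiv.swap i.castSucc i.succ

lemma adj_mul_self (i : Fin m) : adj i * adj i = 1 := Equiv.swap_mul_self _ _

lemma mul_adj_mul_adj (σ : Equiv.Perm (Fin (m + 1))) (i : Fin m) : σ * adj i * adj i = σ := by
  rw [mul_assoc, adj_mul_self, mul_one]

@[simp] lemma mul_adj_castSucc (σ : Equiv.Perm (Fin (m + 1))) (i : Fin m) :
    (σ * adj i) i.castSucc = σ i.succ := by simp [adj]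

@[simp] lemma mul_adj_succ (σ : Equiv.Perm (Fin (m + 1))) (i : Fin m) :
    (σ * adj i) i.succ = σ i.castSucc := by simp [adj]

lemma mul_adj_of_ne (σ : Equiv.Perm (Fin (m + 1))) (i : Fin m) {a : Fin (m + 1)}
    (h₁ : a ≠ i.castSucc) (h₂ : a ≠ i.succ) : (σ * adj i) a = σ a := by
  simp [adj, Equiv.swap_apply_of_ne_of_ne h₁ h₂]

lemma sum_mul_adj (i : Fin m) (F : Equiv.Perm (Fin (m + 1)) → ℝ) :
    ∑ σ, F (σ * adj i) = ∑ σ, F σ :=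
  Equiv.sum_comp (Equiv.mulRight (adj i)) F

/-- The probability of swapping the entries at positions `i` and `i + 1`. -/
noncomputable def swapProb (team : Fin (m + 1) → Fin k) (s : Fin k → ℝ) (i : Fin m)
    (σ : Equiv.Perm (Fin (m + 1))) : ℝ :=
  s (team (σ i.castSucc)) / (s (team (σ i.castSucc)) + s (team (σ i.succ)))

variable (team : Fin (m + 1) → Fin k) (s : Fin k → ℝ)

lemma one_sub_swapProb (hs : ∀ j, 0 < s j) (i : Fin m) (σ : Equiv.Perm (Fin (m + 1))) :
    1 - swapProb team s i σ =
      s (team (σ i.succ)) / (s (team (σ i.castSucc)) + s (team (σ i.succ))) := by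
  have h₁ := hs (team (σ i.castSucc))
  have h₂ := hs (team (σ i.succ))
  unfold swapProb
  field_simp
  ring

lemma sum_sum_ite_succ (F : Fin (m + 1) → Fin (m + 1) → ℝ) :
    ∑ i : Fin (m + 1), ∑ j : Fin (m + 1), (if (j : ℕ) = (i : ℕ) + 1 then F i j else 0) =
      ∑ i : Fin m, F i.castSucc i.succ := by
  rw [Fin.sum_univ_castSucc]
  have h : ∑ j : Fin (m + 1), (if (j : ℕ) = (Fin.last m : ℕ) + 1 then F (Fin.last m) j else 0)
      = 0 := by
    refine sum_eq_zero fun j _ => if_neg ?_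
    have := j.isLt
    simp only [Fin.val_last]
    omega
  rw [h, add_zero]
  refine sum_congr rfl fun i _ => ?_
  rw [sum_eq_single i.succ]
  · simp
  · intro j _ hj
    refine if_neg fun h => hj (Fin.ext ?_)
    simpa using h
  · simp

lemma gladP_mulVec (hs : ∀ j, 0 < s j) (f : Equiv.Perm (Fin (m + 1)) → ℝ)
    (σ : Equiv.Perm (Fin (m + 1))) :
    (gladP (m + 1) k team s).mulVec f σ = (1 / (m : ℝ)) * ∑ i : Fin m,
      (swapProb team s i σ * f (σ * adj i) + (1 - swapProb team s i σ) * f σ) := by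
  have h : ∀ τ, gladP (m + 1) k team s σ τ = (1 / (m : ℝ)) * ∑ i : Fin m,
      (swapProb team s i σ * (if τ = σ * adj i then 1 else 0) +
        (1 - swapProb team s i σ) * (if τ = σ then 1 else 0)) := by
    intro τ
    unfold gladP
    rw [sum_sum_ite_succ]
    simp only [one_sub_swapProb team s hs]
    push_cast
    rw [add_sub_cancel_right]
    rfl
  simp only [Matrix.mulVec, dotProduct, h, mul_assoc, ← mul_sum, sum_mul]
  rw [sum_comm]
  simp [add_mul, sum_add_distrib]

lemma gladW_eq (σ : Equiv.Perm (Fin (m + 1))) :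
    gladW (m + 1) k team s σ = ∏ a, s (team (σ a)) ^ ((a : ℕ) + 1) := by
  unfold gladW
  rw [← Equiv.prod_comp σ]
  simp

lemma gladW_pos (hs : ∀ j, 0 < s j) (σ : Equiv.Perm (Fin (m + 1))) :
    0 < gladW (m + 1) k team s σ :=
  prod_pos fun _ _ => pow_pos (hs _) _

lemma gladW_mul_adj (σ : Equiv.Perm (Fin (m + 1))) (i : Fin m) :
    gladW (m + 1) k team s (σ * adj i) * s (team (σ i.succ)) =
      gladW (m + 1) k team s σ * s (team (σ i.castSucc)) := by
  have hne : i.succ ∈ univ.erase i.castSucc := by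
    simp [(Fin.castSucc_lt_succ (i := i)).ne']
  have hrest : ∏ a ∈ (univ.erase i.castSucc).erase i.succ,
      s (team ((σ * adj i) a)) ^ ((a : ℕ) + 1) =
      ∏ a ∈ (univ.erase i.castSucc).erase i.succ, s (team (σ a)) ^ ((a : ℕ) + 1) := by
    refine prod_congr rfl fun a ha => ?_
    simp only [mem_erase, mem_univ, and_true] at ha
    rw [mul_adj_of_ne σ i ha.2 ha.1]
  rw [gladW_eq, gladW_eq, ← mul_prod_erase _ _ (mem_univ i.castSucc),
    ← mul_prod_erase _ _ hne, hrest, ← mul_prod_erase univ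
      (fun a => s (team (σ a)) ^ ((a : ℕ) + 1)) (mem_univ i.castSucc),
    ← mul_prod_erase _ (fun a => s (team (σ a)) ^ ((a : ℕ) + 1)) hne]
  simp only [mul_adj_castSucc, mul_adj_succ, Fin.val_castSucc, Fin.val_succ]
  ring

lemma gladPi_pos (hs : ∀ j, 0 < s j) (σ : Equiv.Perm (Fin (m + 1))) :
    0 < gladPi (m + 1) k team s σ :=
  div_pos (gladW_pos team s hs σ) (sum_pos (fun τ _ => gladW_pos team s hs τ) univ_nonempty)

lemma sum_gladPi (hs : ∀ j, 0 < s j) : ∑ σ, gladPi (m + 1) k team s σ = 1 := by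
  unfold gladPi
  rw [← sum_div]
  exact div_self (sum_pos (fun τ _ => gladW_pos team s hs τ) univ_nonempty).ne'

lemma gladPi_mul_adj (σ : Equiv.Perm (Fin (m + 1))) (i : Fin m) :
    gladPi (m + 1) k team s (σ * adj i) * s (team (σ i.succ)) =
      gladPi (m + 1) k team s σ * s (team (σ i.castSucc)) := by
  unfold gladPi
  rw [div_mul_eq_mul_div, gladW_mul_adj, div_mul_eq_mul_div]

/-- Detailed balance. -/
lemma gladPi_mul_swapProb (i : Fin m) (σ : Equiv.Perm (Fin (m + 1))) :
    gladPi (m + 1) k team s (σ * adj i) * swapProb team s i (σ * adj i) =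
      gladPi (m + 1) k team s σ * swapProb team s i σ := by
  unfold swapProb
  rw [mul_adj_castSucc, mul_adj_succ, ← mul_div_assoc, ← mul_div_assoc, gladPi_mul_adj,
    add_comm (s (team (σ i.succ)))]

lemma sum_gladPi_swapProb (i : Fin m) (g : Equiv.Perm (Fin (m + 1)) → ℝ) :
    ∑ σ, gladPi (m + 1) k team s σ * swapProb team s i σ * g (σ * adj i) =
      ∑ σ, gladPi (m + 1) k team s σ * swapProb team s i σ * g σ := by
  rw [← sum_mul_adj i]
  simp only [gladPi_mul_swapProb, mul_adj_mul_adj]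

/-- The Dirichlet form of adjacent transpositions, without rates. -/
noncomputable def energy (f : Equiv.Perm (Fin (m + 1)) → ℝ) : ℝ :=
  ∑ σ, gladPi (m + 1) k team s σ * ∑ i : Fin m, (f σ - f (σ * adj i)) ^ 2

lemma sum_gladPi_mulVec (hm : 0 < m) (hs : ∀ j, 0 < s j)
    (f : Equiv.Perm (Fin (m + 1)) → ℝ) :
    ∑ σ, gladPi (m + 1) k team s σ * (gladP (m + 1) k team s).mulVec f σ =
      ∑ σ, gladPi (m + 1) k team s σ * f σ := by
  have hm' : (m : ℝ) ≠ 0 := by exact_mod_cast hm.ne'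
  have h : ∀ i : Fin m, ∑ σ, gladPi (m + 1) k team s σ *
      (swapProb team s i σ * f (σ * adj i) + (1 - swapProb team s i σ) * f σ) =
      ∑ σ, gladPi (m + 1) k team s σ * f σ := by
    intro i
    have e : ∀ σ, gladPi (m + 1) k team s σ *
        (swapProb team s i σ * f (σ * adj i) + (1 - swapProb team s i σ) * f σ) =
        gladPi (m + 1) k team s σ * swapProb team s i σ * f (σ * adj i) -
          gladPi (m + 1) k team s σ * swapProb team s i σ * f σ +
          gladPi (m + 1) k team s σ * f σ := by
      intro σ; ring
    simp only [e, sum_add_distrib, sum_sub_distrib, sum_gladPi_swapProb]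
    ring
  simp only [gladP_mulVec team s hs, mul_left_comm _ (1 / (m : ℝ)), ← mul_sum]
  simp only [mul_sum (s := (univ : Finset (Fin m)))]
  rw [sum_comm]
  simp only [h]
  simp [hm']

lemma gladP_mulVec_one (hm : 0 < m) (hs : ∀ j, 0 < s j) :
    (gladP (m + 1) k team s).mulVec (fun _ => 1) = fun _ => 1 := by
  have hm' : (m : ℝ) ≠ 0 := by exact_mod_cast hm.ne'
  funext σ
  rw [gladP_mulVec team s hs]
  simp [hm']

/-- One step of the chain lowers the second moment by a multiple of the energy. -/
lemma sum_gladPi_mulVec_sq_le (hm : 0 < m) (hs : ∀ j, 0 < s j) (c : ℝ)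
    (hc : ∀ i σ, c ≤ swapProb team s i σ * (1 - swapProb team s i σ))
    (f : Equiv.Perm (Fin (m + 1)) → ℝ) :
    ∑ σ, gladPi (m + 1) k team s σ * (gladP (m + 1) k team s).mulVec f σ ^ 2 ≤
      ∑ σ, gladPi (m + 1) k team s σ * f σ ^ 2 - c / m * energy team s f := by
  have hm' : (0 : ℝ) < m := by exact_mod_cast hm
  set π := gladPi (m + 1) k team s with hπ
  have hπ0 : ∀ σ, 0 < π σ := gladPi_pos team s hs
  have hstep : ∀ i : Fin m, ∑ σ, π σ *
      (swapProb team s i σ * f (σ * adj i) + (1 - swapProb team s i σ) * f σ) ^ 2 ≤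
      ∑ σ, π σ * f σ ^ 2 - c * ∑ σ, π σ * (f σ - f (σ * adj i)) ^ 2 := by
    intro i
    have e : ∀ σ, π σ *
        (swapProb team s i σ * f (σ * adj i) + (1 - swapProb team s i σ) * f σ) ^ 2 =
        π σ * swapProb team s i σ * f (σ * adj i) ^ 2 - π σ * swapProb team s i σ * f σ ^ 2 +
          π σ * f σ ^ 2 - swapProb team s i σ * (1 - swapProb team s i σ) *
            (π σ * (f σ - f (σ * adj i)) ^ 2) := by
      intro σ; ring
    have h := sum_gladPi_swapProb team s i (fun σ => f σ ^ 2)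
    simp only [← hπ] at h
    simp only [e, sum_add_distrib, sum_sub_distrib, h, sub_self, zero_add]
    rw [mul_sum]
    gcongr with σ
    · exact mul_nonneg (hπ0 σ).le (sq_nonneg _)
    · exact hc i σ
  have hconv : ∀ σ, (gladP (m + 1) k team s).mulVec f σ ^ 2 ≤ (1 / (m : ℝ)) * ∑ i : Fin m,
      (swapProb team s i σ * f (σ * adj i) + (1 - swapProb team s i σ) * f σ) ^ 2 := by
    intro σ
    rw [gladP_mulVec team s hs, mul_pow]
    have := sq_sum_le_card_mul_sum_sq (s := (univ : Finset (Fin m)))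
      (f := fun i => swapProb team s i σ * f (σ * adj i) + (1 - swapProb team s i σ) * f σ)
    rw [card_univ, Fintype.card_fin] at this
    calc _ ≤ (1 / (m : ℝ)) ^ 2 * _ := mul_le_mul_of_nonneg_left this (by positivity)
      _ = _ := by
        rw [← mul_assoc]
        congr 1
        field_simp
  calc _ ≤ ∑ σ, π σ * ((1 / (m : ℝ)) * ∑ i : Fin m,
      (swapProb team s i σ * f (σ * adj i) + (1 - swapProb team s i σ) * f σ) ^ 2) :=
        sum_le_sum fun σ _ => mul_le_mul_of_nonneg_left (hconv σ) (hπ0 σ).le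
    _ = (1 / (m : ℝ)) * ∑ i : Fin m, ∑ σ, π σ *
      (swapProb team s i σ * f (σ * adj i) + (1 - swapProb team s i σ) * f σ) ^ 2 := by
        simp only [mul_left_comm _ (1 / (m : ℝ)), ← mul_sum]
        simp only [mul_sum (s := (univ : Finset (Fin m)))]
        rw [sum_comm]
        simp only [← mul_sum]
    _ ≤ (1 / (m : ℝ)) * ∑ i : Fin m,
        (∑ σ, π σ * f σ ^ 2 - c * ∑ σ, π σ * (f σ - f (σ * adj i)) ^ 2) := by
        gcongr with i
        exact hstep i
    _ = _ := by
        have e : energy team s f = ∑ i : Fin m, ∑ σ, π σ * (f σ - f (σ * adj i)) ^ 2 := by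
          unfold energy
          simp only [mul_sum]
          rw [sum_comm]
        rw [e, sum_sub_distrib, ← mul_sum]
        simp
        field_simp

end Chain

section WithinTeams

variable {m k : ℕ}

lemma sqrt_sum_sq_add_le {ι : Type*} (t : Finset ι) (a b : ι → ℝ) :
    √(∑ i ∈ t, (a i + b i) ^ 2) ≤ √(∑ i ∈ t, a i ^ 2) + √(∑ i ∈ t, b i ^ 2) := by
  have ha : 0 ≤ ∑ i ∈ t, a i ^ 2 := sum_nonneg fun _ _ => sq_nonneg _
  have hb : 0 ≤ ∑ i ∈ t, b i ^ 2 := sum_nonneg fun _ _ => sq_nonneg _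
  refine Real.sqrt_le_iff.2 ⟨by positivity, ?_⟩
  have h := Real.sum_mul_le_sqrt_mul_sqrt t a b
  have e : ∑ i ∈ t, (a i + b i) ^ 2 =
      ∑ i ∈ t, a i ^ 2 + 2 * ∑ i ∈ t, a i * b i + ∑ i ∈ t, b i ^ 2 := by
    rw [mul_sum, ← sum_add_distrib, ← sum_add_distrib]
    exact sum_congr rfl fun i _ => by ring
  rw [e, add_sq, Real.sq_sqrt ha, Real.sq_sqrt hb]
  linarith

variable (team : Fin (m + 1) → Fin k) (s : Fin k → ℝ)

open Classical in
/-- The permutations in which the teams appear in increasing order. -/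
noncomputable def sortedPerms : Finset (Equiv.Perm (Fin (m + 1))) :=
  univ.filter fun σ => Monotone fun a => team (σ a)

lemma mem_sortedPerms {σ : Equiv.Perm (Fin (m + 1))} :
    σ ∈ sortedPerms team ↔ Monotone fun a => team (σ a) := by
  simp [sortedPerms]

lemma team_eq_of_mem_sortedPerms {u v : Equiv.Perm (Fin (m + 1))} (hu : u ∈ sortedPerms team)
    (hv : v ∈ sortedPerms team) (a : Fin (m + 1)) : team (u a) = team (v a) :=
  congrFun (Tuple.unique_monotone (f := team) ((mem_sortedPerms team).1 hu)
    ((mem_sortedPerms team).1 hv)) a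

lemma gladPi_eq_of_mem_sortedPerms {u v : Equiv.Perm (Fin (m + 1))} (hu : u ∈ sortedPerms team)
    (hv : v ∈ sortedPerms team) :
    gladPi (m + 1) k team s u = gladPi (m + 1) k team s v := by
  unfold gladPi
  rw [gladW_eq, gladW_eq]
  simp only [team_eq_of_mem_sortedPerms team hu hv]

/-- The `L²` size over `R` of the change of `f` under right multiplication by `h`. -/
noncomputable def shiftNorm (R : Finset (Equiv.Perm (Fin (m + 1))))
    (f : Equiv.Perm (Fin (m + 1)) → ℝ) (h : Equiv.Perm (Fin (m + 1))) : ℝ :=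
  √(∑ u ∈ R, (f u - f (u * h)) ^ 2)

lemma shiftNorm_one (R : Finset (Equiv.Perm (Fin (m + 1))))
    (f : Equiv.Perm (Fin (m + 1)) → ℝ) : shiftNorm R f 1 = 0 := by
  simp [shiftNorm]

lemma mul_mem_sortedPerms_iff {u₀ u h : Equiv.Perm (Fin (m + 1))} (h₀ : u₀ ∈ sortedPerms team)
    (hh : ∀ a, team (u₀ (h a)) = team (u₀ a)) :
    u ∈ sortedPerms team ↔ u * h ∈ sortedPerms team := by
  constructor
  · intro hu
    rw [mem_sortedPerms] at hu ⊢
    convert hu using 2 with a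
    rw [Equiv.Perm.mul_apply, team_eq_of_mem_sortedPerms team ((mem_sortedPerms team).2 hu) h₀,
      hh, ← team_eq_of_mem_sortedPerms team ((mem_sortedPerms team).2 hu) h₀]
  · intro hu
    have key : ∀ a, team (u a) = team (u₀ a) := by
      intro a
      have h1 := team_eq_of_mem_sortedPerms team hu h₀ (h.symm a)
      have h2 := hh (h.symm a)
      simp only [Equiv.Perm.mul_apply, Equiv.apply_symm_apply] at h1 h2
      rw [h1, h2]
    rw [mem_sortedPerms] at h₀ ⊢
    simpa only [key] using h₀

lemma shiftNorm_mul_le {u₀ g h : Equiv.Perm (Fin (m + 1))} (h₀ : u₀ ∈ sortedPerms team)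
    (hg : ∀ a, team (u₀ (g a)) = team (u₀ a)) (f : Equiv.Perm (Fin (m + 1)) → ℝ) :
    shiftNorm (sortedPerms team) f (g * h) ≤
      shiftNorm (sortedPerms team) f g + shiftNorm (sortedPerms team) f h := by
  have e : ∑ u ∈ sortedPerms team, (f (u * g) - f (u * g * h)) ^ 2 =
      ∑ u ∈ sortedPerms team, (f u - f (u * h)) ^ 2 :=
    sum_equiv (Equiv.mulRight g) (fun u => mul_mem_sortedPerms_iff team h₀ hg) (fun u _ => rfl)
  have := sqrt_sum_sq_add_le (sortedPerms team) (fun u => f u - f (u * g))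
    (fun u => f (u * g) - f (u * g * h))
  rw [e] at this
  simpa only [shiftNorm, sub_add_sub_cancel, mul_assoc] using this

lemma team_swap_eq {u₀ : Equiv.Perm (Fin (m + 1))} {a b : Fin (m + 1)}
    (hab : team (u₀ a) = team (u₀ b)) (c : Fin (m + 1)) :
    team (u₀ (Equiv.swap a b c)) = team (u₀ c) := by
  by_cases h1 : c = a
  · subst h1; simp [hab]
  by_cases h2 : c = b
  · subst h2; simp [hab]
  rw [Equiv.swap_apply_of_ne_of_ne h1 h2]

lemma shiftNorm_swap_le {u₀ : Equiv.Perm (Fin (m + 1))} (h₀ : u₀ ∈ sortedPerms team)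
    (f : Equiv.Perm (Fin (m + 1)) → ℝ) (M : ℝ)
    (hM : ∀ i, shiftNorm (sortedPerms team) f (adj i) ≤ M) (d : ℕ) :
    ∀ a b : Fin (m + 1), (b : ℕ) = a + (d + 1) → team (u₀ a) = team (u₀ b) →
      shiftNorm (sortedPerms team) f (Equiv.swap a b) ≤ (2 * d + 1) * M := by
  have hmono : Monotone fun a => team (u₀ a) := (mem_sortedPerms team).1 h₀
  induction d with
  | zero =>
    intro a b hab _
    have ha : (a : ℕ) < m := by have := b.isLt; omega
    have e : Equiv.swap a b = adj (⟨a, ha⟩ : Fin m) := by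
      unfold adj
      congr 1
      exact Fin.ext (by simpa using hab)
    rw [e]
    simpa using hM ⟨a, ha⟩
  | succ d ih =>
    intro a b hab ht
    obtain ⟨i, rfl⟩ : ∃ i : Fin m, i.succ = b :=
      Fin.exists_succ_eq.2 (by rintro rfl; simp at hab)
    have hi : ((i.castSucc : Fin (m + 1)) : ℕ) = a + (d + 1) := by
      simp only [Fin.val_succ] at hab
      simp only [Fin.val_castSucc]
      omega
    have hai : a ≤ i.castSucc := Fin.le_def.2 (by omega)
    have ht1 : team (u₀ a) = team (u₀ i.castSucc) :=
      le_antisymm (hmono hai) (ht ▸ hmono (Fin.castSucc_lt_succ (i := i)).le)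
    have ht2 : team (u₀ i.castSucc) = team (u₀ i.succ) := ht1 ▸ ht
    have hne1 : a ≠ i.castSucc := by
      intro h
      rw [← h] at hi
      omega
    have hne2 : a ≠ i.succ := by
      intro h
      rw [← h] at hab
      omega
    have e : Equiv.swap a i.succ = adj i * (Equiv.swap a i.castSucc * adj i) := by
      rw [← mul_assoc, adj, Equiv.swap_mul_swap_mul_swap hne1 hne2, Equiv.swap_comm]
    have h1 := shiftNorm_mul_le team (h := Equiv.swap a i.castSucc * adj i) h₀
      (team_swap_eq team ht2) f
    have h2 := shiftNorm_mul_le team (h := adj i) h₀ (team_swap_eq team ht1) f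
    have h3 := ih a i.castSucc hi ht1
    have h4 := hM i
    rw [e]
    push_cast
    change shiftNorm _ f (adj i * _) ≤ shiftNorm _ f (adj i) + _ at h1
    linarith

lemma shiftNorm_le {u₀ : Equiv.Perm (Fin (m + 1))} (h₀ : u₀ ∈ sortedPerms team)
    (f : Equiv.Perm (Fin (m + 1)) → ℝ) (M : ℝ) (hM0 : 0 ≤ M)
    (hM : ∀ i, shiftNorm (sortedPerms team) f (adj i) ≤ M) (j : ℕ) (hj : j ≤ m + 1) :
    ∀ h : Equiv.Perm (Fin (m + 1)), (∀ a, team (u₀ (h a)) = team (u₀ a)) →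
      (∀ a : Fin (m + 1), j ≤ a → h a = a) →
      shiftNorm (sortedPerms team) f h ≤ j * (2 * (m + 1) * M) := by
  induction j with
  | zero =>
    intro h _ hfix
    have : h = 1 := Equiv.ext fun a => hfix a (Nat.zero_le _)
    rw [this, shiftNorm_one]
    simp
  | succ j ih =>
    intro h hh hfix
    have ih := ih (by omega)
    have hK : 0 ≤ 2 * ((m : ℝ) + 1) * M := by positivity
    let a : Fin (m + 1) := ⟨j, by omega⟩
    by_cases hb : h a = a
    · refine (ih h hh fun c hc => ?_).trans ?_
      · rcases hc.eq_or_lt with hc | hc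
        · rwa [show c = a from Fin.ext hc.symm]
        · exact hfix c hc
      · push_cast
        linarith
    · have hlt : h a < a := by
        by_contra hge
        have hgt : a < h a := lt_of_le_of_ne (not_lt.1 hge) (Ne.symm hb)
        have h1 := hfix (h a) (Nat.succ_le_of_lt (Fin.lt_def.1 hgt))
        exact hb (h.injective h1)
      have ht : team (u₀ (h a)) = team (u₀ a) := hh a
      have hsw := team_swap_eq team ht
      have e : h = Equiv.swap (h a) a * (Equiv.swap (h a) a * h) := by
        rw [← mul_assoc, Equiv.swap_mul_self, one_mul]
      have h1 := ih (Equiv.swap (h a) a * h) (fun c => by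
        rw [Equiv.Perm.mul_apply, hsw, hh]) (fun c hc => by
          rw [Equiv.Perm.mul_apply]
          rcases hc.eq_or_lt with hc | hc
          · rw [show c = a from Fin.ext hc.symm, Equiv.swap_apply_left]
          · have hca : c ≠ a := by
              rintro rfl
              exact lt_irrefl _ hc
            have hcf := hfix c hc
            rw [hcf]
            refine Equiv.swap_apply_of_ne_of_ne (fun hch => hca ?_) hca
            exact h.injective (hcf.trans hch))
      obtain ⟨d, hd⟩ : ∃ d : ℕ, (a : ℕ) = (h a : ℕ) + (d + 1) :=
        ⟨a - h a - 1, by have := Fin.lt_def.1 hlt; omega⟩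
      have h2 := shiftNorm_swap_le team h₀ f M hM d (h a) a hd ht
      have h3 := shiftNorm_mul_le team (h := Equiv.swap (h a) a * h) h₀ hsw f
      rw [← e] at h3
      have hdm : 2 * (d : ℝ) + 1 ≤ 2 * (m + 1) := by
        have := a.isLt
        have : 2 * d + 1 ≤ 2 * (m + 1) := by omega
        exact_mod_cast this
      have h4 := mul_le_mul_of_nonneg_right hdm hM0
      push_cast
      linarith

/-- A Poincaré inequality on the set of sorted permutations. -/
lemma exists_sum_sortedPerms_le (hs : ∀ j, 0 < s j) (f : Equiv.Perm (Fin (m + 1)) → ℝ) :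
    ∃ c : ℝ, ∑ σ ∈ sortedPerms team, gladPi (m + 1) k team s σ * (f σ - c) ^ 2 ≤
      4 * ((m : ℝ) + 1) ^ 4 * energy team s f := by
  set R := sortedPerms team with hR
  set π := gladPi (m + 1) k team s with hπ
  have hπ0 : ∀ σ, 0 < π σ := gladPi_pos team s hs
  obtain ⟨u₀, h₀⟩ : ∃ u₀, u₀ ∈ R :=
    ⟨Tuple.sort team, (mem_sortedPerms team).2 (Tuple.monotone_sort team)⟩
  have hcard : 0 < (R.card : ℝ) := by exact_mod_cast card_pos.2 ⟨u₀, h₀⟩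
  set E := ∑ u ∈ R, ∑ i : Fin m, (f u - f (u * adj i)) ^ 2 with hE
  have hE0 : 0 ≤ E := sum_nonneg fun _ _ => sum_nonneg fun _ _ => sq_nonneg _
  have hadj : ∀ i, shiftNorm R f (adj i) ≤ √E := by
    intro i
    refine Real.sqrt_le_sqrt (sum_le_sum fun u _ => ?_)
    exact single_le_sum (f := fun i => (f u - f (u * adj i)) ^ 2)
      (fun _ _ => sq_nonneg _) (mem_univ i)
  have hshift : ∀ h : Equiv.Perm (Fin (m + 1)), (∀ a, team (u₀ (h a)) = team (u₀ a)) →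
      ∑ u ∈ R, (f u - f (u * h)) ^ 2 ≤ 4 * ((m : ℝ) + 1) ^ 4 * E := by
    intro h hh
    have h1 := shiftNorm_le team h₀ f (√E) (Real.sqrt_nonneg _) hadj (m + 1) le_rfl h hh
      (fun a ha => absurd a.isLt (by omega))
    unfold shiftNorm at h1
    have h2 := (Real.sqrt_le_left (by positivity)).1 h1
    refine h2.trans (le_of_eq ?_)
    rw [mul_pow, mul_pow, Real.sq_sqrt hE0]
    push_cast
    ring
  let S := univ.filter fun h : Equiv.Perm (Fin (m + 1)) => ∀ a, team (u₀ (h a)) = team (u₀ a)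
  have hmemS : ∀ h, h ∈ S ↔ ∀ a, team (u₀ (h a)) = team (u₀ a) := fun h => by simp [S]
  have hmem : ∀ u ∈ R, ∀ h, h ∈ S ↔ u * h ∈ R := by
    intro u hu h
    rw [hmemS]
    refine ⟨fun hh => (mul_mem_sortedPerms_iff team h₀ hh).1 hu, fun huh a => ?_⟩
    have h1 := team_eq_of_mem_sortedPerms team huh h₀ a
    have h2 := team_eq_of_mem_sortedPerms team hu h₀ (h a)
    rw [← h1, ← h2]
    rfl
  have hcards : S.card = R.card :=
    card_equiv (Equiv.mulLeft u₀) (fun h => hmem u₀ h₀ h)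
  have hdouble : ∑ u ∈ R, ∑ v ∈ R, (f u - f v) ^ 2 ≤
      R.card * (4 * ((m : ℝ) + 1) ^ 4 * E) := by
    calc ∑ u ∈ R, ∑ v ∈ R, (f u - f v) ^ 2
        = ∑ u ∈ R, ∑ h ∈ S, (f u - f (u * h)) ^ 2 :=
          sum_congr rfl fun u hu =>
            (sum_equiv (Equiv.mulLeft u) (fun h => hmem u hu h) (fun h _ => rfl)).symm
      _ = ∑ h ∈ S, ∑ u ∈ R, (f u - f (u * h)) ^ 2 := sum_comm
      _ ≤ ∑ h ∈ S, 4 * ((m : ℝ) + 1) ^ 4 * E :=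
          sum_le_sum fun h hh => hshift h ((hmemS h).1 hh)
      _ = _ := by rw [sum_const, hcards, nsmul_eq_mul]
  let c : ℝ := (∑ v ∈ R, f v) / R.card
  have hvar : ∑ u ∈ R, (f u - c) ^ 2 ≤ 4 * ((m : ℝ) + 1) ^ 4 * E := by
    have h1 : ∀ u, R.card * (f u - c) ^ 2 ≤ ∑ v ∈ R, (f u - f v) ^ 2 := by
      intro u
      have h2 := sq_sum_le_card_mul_sum_sq (s := R) (f := fun v => f u - f v)
      have h3 : ∑ v ∈ R, (f u - f v) = R.card * (f u - c) := by
        rw [sum_sub_distrib, sum_const, nsmul_eq_mul]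
        simp only [c]
        field_simp
      rw [h3, mul_pow, pow_two (R.card : ℝ), mul_assoc] at h2
      exact le_of_mul_le_mul_left h2 hcard
    refine le_of_mul_le_mul_left ?_ hcard
    rw [mul_sum]
    exact (sum_le_sum fun u _ => h1 u).trans hdouble
  refine ⟨c, ?_⟩
  have hconst : ∀ u ∈ R, π u = π u₀ := fun u hu => gladPi_eq_of_mem_sortedPerms team s hu h₀
  calc ∑ u ∈ R, π u * (f u - c) ^ 2 = π u₀ * ∑ u ∈ R, (f u - c) ^ 2 := by
        rw [mul_sum]
        exact sum_congr rfl fun u hu => by rw [hconst u hu]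
    _ ≤ π u₀ * (4 * ((m : ℝ) + 1) ^ 4 * E) := mul_le_mul_of_nonneg_left hvar (hπ0 _).le
    _ = 4 * ((m : ℝ) + 1) ^ 4 * ∑ u ∈ R, π u * ∑ i : Fin m, (f u - f (u * adj i)) ^ 2 := by
        rw [sum_congr rfl fun u hu => by rw [hconst u hu], ← mul_sum]
        ring
    _ ≤ 4 * ((m : ℝ) + 1) ^ 4 * energy team s f := by
        refine mul_le_mul_of_nonneg_left ?_ (by positivity)
        exact sum_le_univ_sum_of_nonneg fun u =>
          mul_nonneg (hπ0 u).le (sum_nonneg fun _ _ => sq_nonneg _)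

end WithinTeams

section Sorting

variable {m : ℕ}

lemma of_le_of_forall_succ {p : Fin (m + 1) → Prop} {N : ℕ}
    (h : ∀ j : Fin m, (j : ℕ) + 1 < N → p j.succ → p j.castSucc) (a b : Fin (m + 1))
    (hab : a ≤ b) (hb : (b : ℕ) < N) (hpb : p b) : p a := by
  induction b using Fin.induction with
  | zero => rwa [Fin.le_zero_iff.1 hab]
  | succ b ih =>
    rcases hab.eq_or_lt with rfl | hlt
    · exact hpb
    · simp only [Fin.val_succ] at hb
      refine ih (Fin.le_castSucc_iff.2 hlt) ?_ (h b hb hpb)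
      simp only [Fin.val_castSucc]
      omega

open Classical in
/-- Positions at which the last move of the sorting procedure for `p` may have taken place. -/
noncomputable def lastMoves (p : Fin (m + 1) → Prop) : Finset (Fin m) :=
  univ.filter fun i => p i.castSucc ∧ ¬ p i.succ ∧
    ∀ j : Fin m, (j : ℕ) + 1 < i → p j.succ → p j.castSucc

lemma mem_lastMoves {p : Fin (m + 1) → Prop} {i : Fin m} :
    i ∈ lastMoves p ↔ p i.castSucc ∧ ¬ p i.succ ∧
      ∀ j : Fin m, (j : ℕ) + 1 < i → p j.succ → p j.castSucc := by
  simp [lastMoves]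

lemma card_lastMoves_le_two (p : Fin (m + 1) → Prop) : (lastMoves p).card ≤ 2 := by
  have key : ∀ i ∈ lastMoves p, ∀ j ∈ lastMoves p, ∀ l ∈ lastMoves p, i < j → j < l → False := by
    intro i hi j hj l hl hij hjl
    rw [mem_lastMoves] at hi hj hl
    refine hi.2.1 (of_le_of_forall_succ hl.2.2 i.succ j.castSucc ?_ ?_ hj.1)
    · rwa [Fin.succ_le_castSucc_iff]
    · simpa using hjl
  by_contra hcon
  obtain ⟨a, b, c, ha, hb, hc, hab, hac, hbc⟩ := two_lt_card_iff.1 (not_le.1 hcon)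
  rcases lt_or_gt_of_ne hab with h1 | h1 <;> rcases lt_or_gt_of_ne hac with h2 | h2 <;>
    rcases lt_or_gt_of_ne hbc with h3 | h3
  · exact key a ha b hb c hc h1 h3
  · exact key a ha c hc b hb h2 h3
  · exact lt_asymm (h1.trans h3) h2
  · exact key c hc a ha b hb h2 h1
  · exact key b hb a ha c hc h1 h2
  · exact lt_asymm (h2.trans h3) h1
  · exact key b hb c hc a ha h3 h2
  · exact key c hc b hb a ha h3 h1

lemma card_lastMoves_le_one {p : Fin (m + 1) → Prop}
    (hp : ∀ j : Fin m, p j.succ → p j.castSucc) : (lastMoves p).card ≤ 1 := by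
  have key : ∀ i ∈ lastMoves p, ∀ j ∈ lastMoves p, ¬ i < j := by
    intro i hi j hj hij
    rw [mem_lastMoves] at hi hj
    refine hi.2.1 (of_le_of_forall_succ (N := m + 1) (fun j _ => hp j) i.succ j.castSucc ?_
      (Fin.isLt _) hj.1)
    rwa [Fin.succ_le_castSucc_iff]
  exact card_le_one.2 fun i hi j hj =>
    le_antisymm (not_lt.1 (key j hj i hi)) (not_lt.1 (key i hi j hj))

lemma exists_first_descent {p : Fin (m + 1) → Prop}
    (hp : ¬ ∀ j : Fin m, p j.succ → p j.castSucc) :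
    ∃ i : Fin m, p i.succ ∧ ¬ p i.castSucc ∧ ∀ j : Fin m, j < i → p j.succ → p j.castSucc := by
  classical
  push Not at hp
  let D : Finset (Fin m) := univ.filter fun j => p j.succ ∧ ¬ p j.castSucc
  have hD : D.Nonempty := by
    obtain ⟨j, hj⟩ := hp
    exact ⟨j, by simpa [D] using hj⟩
  have hmin := D.min'_mem hD
  simp only [D, mem_filter, mem_univ, true_and] at hmin
  refine ⟨D.min' hD, hmin.1, hmin.2, fun j hj h1 => ?_⟩
  by_contra h2
  exact absurd (D.min'_le j (by simp [D, h1, h2])) (not_le.2 hj)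

variable (team : Fin (m + 1) → Fin 3) (s : Fin 3 → ℝ)

/-- All members of the weakest team precede all other gladiators. -/
def WeakestFirst (σ : Equiv.Perm (Fin (m + 1))) : Prop :=
  ∀ j : Fin m, team (σ j.succ) = 0 → team (σ j.castSucc) = 0

/-- Position `i` is the one at which the sorting procedure acts on `σ`: first the members of the
weakest team are moved to the front, from left to right, and then those of the middle team. -/
def SortStep (σ : Equiv.Perm (Fin (m + 1))) (i : Fin m) : Prop :=
  (team (σ i.succ) = 0 ∧ team (σ i.castSucc) ≠ 0 ∧
    ∀ j : Fin m, j < i → team (σ j.succ) = 0 → team (σ j.castSucc) = 0) ∨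
  (WeakestFirst team σ ∧ team (σ i.succ) ≠ 2 ∧ team (σ i.castSucc) = 2 ∧
    ∀ j : Fin m, j < i → team (σ j.succ) ≠ 2 → team (σ j.castSucc) ≠ 2)

lemma exists_sortStep {σ : Equiv.Perm (Fin (m + 1))} (hσ : σ ∉ sortedPerms team) :
    ∃ i, SortStep team σ i := by
  by_cases h0 : WeakestFirst team σ
  · by_cases h2 : ∀ j : Fin m, team (σ j.succ) ≠ 2 → team (σ j.castSucc) ≠ 2
    · refine absurd ((mem_sortedPerms team).2 (Fin.monotone_iff_le_succ.2 fun j => ?_)) hσ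
      have h0 := h0 j
      have h2 := h2 j
      revert h0 h2
      generalize team (σ j.succ) = a
      generalize team (σ j.castSucc) = b
      revert a b
      decide
    · obtain ⟨i, h1, h3, h4⟩ := exists_first_descent (p := fun a => team (σ a) ≠ 2) h2
      exact ⟨i, Or.inr ⟨h0, h1, not_not.1 h3, h4⟩⟩
  · obtain ⟨i, h1, h3, h4⟩ := exists_first_descent (p := fun a => team (σ a) = 0) h0
    exact ⟨i, Or.inl ⟨h1, h3, h4⟩⟩

lemma mul_adj_apply_of_lt (σ : Equiv.Perm (Fin (m + 1))) {i j : Fin m} (hj : (j : ℕ) + 1 < i) :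
    (σ * adj i) j.castSucc = σ j.castSucc ∧ (σ * adj i) j.succ = σ j.succ := by
  constructor <;> refine mul_adj_of_ne σ i (fun h => ?_) (fun h => ?_) <;>
    · have := congrArg Fin.val h
      simp only [Fin.val_castSucc, Fin.val_succ] at this
      omega

lemma lt_of_succ_lt {i j : Fin m} (hj : (j : ℕ) + 1 < i) : j < i := Fin.lt_def.2 (by omega)

open Classical in
/-- The weight of a permutation in the sorting argument. -/
noncomputable def sortWeight (H : ℝ) (σ : Equiv.Perm (Fin (m + 1))) : ℝ :=
  if WeakestFirst team σ then H else 1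

lemma gladPi_mul_adj_le {q : ℝ} (hs : ∀ j, 0 < s j) (σ : Equiv.Perm (Fin (m + 1))) (i : Fin m)
    (h : s (team (σ i.castSucc)) ≤ q * s (team (σ i.succ))) :
    gladPi (m + 1) 3 team s (σ * adj i) ≤ q * gladPi (m + 1) 3 team s σ := by
  have h1 := gladPi_mul_adj team s σ i
  have h2 := mul_le_mul_of_nonneg_left h (gladPi_pos team s hs σ).le
  refine le_of_mul_le_mul_right ?_ (hs (team (σ i.succ)))
  linarith

open Classical in
lemma sum_sortStep_le {q H : ℝ} (hs : ∀ j, 0 < s j) (hq : 0 < q) (hH : q ≤ (1 / 2 - q) * H)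
    (hH0 : 0 < H) (h01 : s 0 ≤ q * s 1) (h02 : s 0 ≤ q * s 2) (h12 : s 1 ≤ q * s 2)
    (σ : Equiv.Perm (Fin (m + 1))) :
    ∑ i : Fin m, (if SortStep team (σ * adj i) i then
      gladPi (m + 1) 3 team s (σ * adj i) * sortWeight team H (σ * adj i) else 0) ≤
      (q + 1 / 2) * (gladPi (m + 1) 3 team s σ * sortWeight team H σ) := by
  set π := gladPi (m + 1) 3 team s with hπ
  have hπ0 : ∀ σ, 0 < π σ := gladPi_pos team s hs
  let U := lastMoves fun a => team (σ a) = 0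
  let V := lastMoves fun a => team (σ a) ≠ 2
  have hterm : ∀ i : Fin m, (if SortStep team (σ * adj i) i then
      π (σ * adj i) * sortWeight team H (σ * adj i) else 0) ≤
      (if i ∈ U then q * π σ else 0) +
        (if WeakestFirst team σ then (if i ∈ V then q * π σ * H else 0) else 0) := by
    intro i
    have hpos := hπ0 σ
    have hA : 0 ≤ if i ∈ U then q * π σ else 0 := by split_ifs <;> positivity
    have hB : 0 ≤ if WeakestFirst team σ then (if i ∈ V then q * π σ * H else 0) else 0 := by
      split_ifs <;> positivity
    by_cases hstep : SortStep team (σ * adj i) i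
    · rw [if_pos hstep]
      rcases hstep with ⟨h1, h2, h3⟩ | ⟨h0, h1, h2, h3⟩
      · have hW : ¬ WeakestFirst team (σ * adj i) := fun h => h2 (h i h1)
        rw [mul_adj_succ] at h1
        rw [mul_adj_castSucc] at h2
        have hU : i ∈ U := by
          refine mem_lastMoves.2 ⟨h1, h2, fun j hj hj' => ?_⟩
          obtain ⟨e1, e2⟩ := mul_adj_apply_of_lt σ hj
          have := h3 j (lt_of_succ_lt hj)
          rw [e1, e2] at this
          exact this hj'
        have hle : π (σ * adj i) ≤ q * π σ := by
          refine gladPi_mul_adj_le team s hs σ i ?_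
          rw [h1]
          revert h2
          generalize team (σ i.succ) = t
          intro h2
          fin_cases t
          · exact absurd rfl h2
          · exact h01
          · exact h02
        rw [sortWeight, if_neg hW, if_pos hU, mul_one]
        linarith
      · have h1' : team ((σ * adj i) i.succ) ≠ 0 := by
          intro h
          have := h0 i h
          rw [h2] at this
          exact absurd this (by decide)
        have hW : WeakestFirst team σ := by
          have hiff : ∀ a, team (σ a) = 0 ↔ team ((σ * adj i) a) = 0 := by
            intro a
            by_cases ha : a = i.castSucc
            · subst ha
              rw [mul_adj_succ] at h1'
              rw [h2]
              simp [h1']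
            by_cases ha' : a = i.succ
            · subst ha'
              rw [mul_adj_castSucc] at h2
              rw [mul_adj_succ] at h1' ⊢
              rw [h2]
              simp [h1']
            rw [mul_adj_of_ne σ i ha ha']
          intro j hj
          rw [hiff] at hj ⊢
          exact h0 j hj
        rw [mul_adj_succ] at h1 h1'
        rw [mul_adj_castSucc] at h2
        have hV : i ∈ V := by
          refine mem_lastMoves.2 ⟨h1, not_not.2 h2, fun j hj hj' => ?_⟩
          obtain ⟨e1, e2⟩ := mul_adj_apply_of_lt σ hj
          have := h3 j (lt_of_succ_lt hj)
          rw [e1, e2] at this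
          exact this hj'
        have hle : π (σ * adj i) ≤ q * π σ := by
          refine gladPi_mul_adj_le team s hs σ i ?_
          rw [h2]
          revert h1 h1'
          generalize team (σ i.castSucc) = t
          intro h1 h1'
          fin_cases t
          · exact absurd rfl h1'
          · exact h12
          · exact absurd rfl h1
        rw [sortWeight, if_pos h0, if_pos hW, if_pos hV]
        have := mul_le_mul_of_nonneg_right hle hH0.le
        linarith
    · rw [if_neg hstep]
      linarith
  refine (sum_le_sum fun i _ => hterm i).trans ?_
  rw [sum_add_distrib]
  have hpos := hπ0 σ
  have hUs : ∑ i : Fin m, (if i ∈ U then q * π σ else 0) = U.card * (q * π σ) := by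
    simp
  by_cases hW : WeakestFirst team σ
  · have hU1 : (U.card : ℝ) ≤ 1 := by
      exact_mod_cast card_lastMoves_le_one (p := fun a => team (σ a) = 0) hW
    have hV2 : (V.card : ℝ) ≤ 2 := by exact_mod_cast card_lastMoves_le_two _
    have hVs : ∑ i : Fin m, (if WeakestFirst team σ then (if i ∈ V then q * π σ * H else 0)
        else 0) = V.card * (q * π σ * H) := by
      simp [hW]
    rw [hUs, hVs, sortWeight, if_pos hW]
    have e1 := mul_le_mul_of_nonneg_right hU1 (by positivity : 0 ≤ q * π σ)
    have e2 := mul_le_mul_of_nonneg_right hV2 (by positivity : 0 ≤ q * π σ * H)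
    have e3 := mul_le_mul_of_nonneg_right hH hpos.le
    linarith
  · have hU2 : (U.card : ℝ) ≤ 2 := by exact_mod_cast card_lastMoves_le_two _
    have hVs : ∑ i : Fin m, (if WeakestFirst team σ then (if i ∈ V then q * π σ * H else 0)
        else 0) = 0 := by
      simp [hW]
    rw [hUs, hVs, sortWeight, if_neg hW]
    have e1 := mul_le_mul_of_nonneg_right hU2 (by positivity : 0 ≤ q * π σ)
    have hq2 : q ≤ 1 / 2 := by
      by_contra hcon
      have : (1 / 2 - q) * H < 0 := mul_neg_of_neg_of_pos (by linarith) hH0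
      linarith
    have e2 := mul_le_mul_of_nonneg_right hq2 hpos.le
    linarith

/-- The Poincaré inequality for the gladiator chain with three teams. -/
lemma poincare {q : ℝ} (hs : ∀ j, 0 < s j) (hq : 0 < q) (hq2 : q < 1 / 2)
    (h01 : s 0 ≤ q * s 1) (h02 : s 0 ≤ q * s 2) (h12 : s 1 ≤ q * s 2)
    (f : Equiv.Perm (Fin (m + 1)) → ℝ) (hf : ∑ σ, gladPi (m + 1) 3 team s σ * f σ = 0) :
    ∑ σ, gladPi (m + 1) 3 team s σ * f σ ^ 2 ≤
      2 / (1 / 2 - q) ^ 2 * (4 * ((m : ℝ) + 1) ^ 4 + 1 + 2 / (1 / 2 - q)) *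
        energy team s f := by
  classical
  obtain ⟨c, hc⟩ := exists_sum_sortedPerms_le team s hs f
  set π := gladPi (m + 1) 3 team s with hπ
  have hπ0 : ∀ σ, 0 < π σ := gladPi_pos team s hs
  set δ := 1 / 2 - q with hδ
  have hδ0 : 0 < δ := by linarith
  have hδ1 : δ < 1 / 2 := by linarith
  let H := 1 / δ
  have hH1 : 1 ≤ H := (one_le_div hδ0).2 (by linarith)
  have hHδ : δ * H = 1 := mul_one_div_cancel hδ0.ne'
  let h := sortWeight team H
  have hh1 : ∀ σ, 1 ≤ h σ := by
    intro σ
    simp only [h, sortWeight]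
    split_ifs
    · exact hH1
    · exact le_rfl
  have hhH : ∀ σ, h σ ≤ H := by
    intro σ
    simp only [h, sortWeight]
    split_ifs
    · exact le_rfl
    · exact hH1
  let g : Equiv.Perm (Fin (m + 1)) → ℝ := fun σ => f σ - c
  let S := ∑ σ, π σ * h σ * g σ ^ 2
  have hvar : ∑ σ, π σ * f σ ^ 2 ≤ S := by
    have e : ∑ σ, π σ * g σ ^ 2 = ∑ σ, π σ * f σ ^ 2 + c ^ 2 := by
      have : ∀ σ, π σ * g σ ^ 2 = π σ * f σ ^ 2 - 2 * c * (π σ * f σ) + c ^ 2 * π σ := by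
        intro σ
        simp only [g]
        ring
      simp only [this, sum_add_distrib, sum_sub_distrib, ← mul_sum, hf]
      rw [sum_gladPi team s hs]
      ring
    have h2 : ∑ σ, π σ * g σ ^ 2 ≤ S := sum_le_sum fun σ _ =>
      mul_le_mul_of_nonneg_right (le_mul_of_one_le_right (hπ0 σ).le (hh1 σ)) (sq_nonneg _)
    nlinarith [sq_nonneg c]
  let F : Equiv.Perm (Fin (m + 1)) → ℝ := fun σ =>
    ∑ i : Fin m, if SortStep team σ i then π σ * h σ * g (σ * adj i) ^ 2 else 0
  have hF0 : ∀ σ, 0 ≤ F σ := fun σ => sum_nonneg fun i _ => by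
    have := hπ0 σ
    have := hh1 σ
    split_ifs <;> positivity
  have hF : ∑ σ, F σ ≤ (1 - δ) * S := by
    calc ∑ σ, F σ = ∑ i : Fin m, ∑ σ,
          (if SortStep team σ i then π σ * h σ * g (σ * adj i) ^ 2 else 0) := sum_comm
      _ = ∑ i : Fin m, ∑ σ, (if SortStep team (σ * adj i) i then
            π (σ * adj i) * h (σ * adj i) * g σ ^ 2 else 0) := by
          refine sum_congr rfl fun i _ => ?_
          rw [← sum_mul_adj i]
          simp only [mul_adj_mul_adj]
      _ = ∑ σ, (∑ i : Fin m, if SortStep team (σ * adj i) i then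
            π (σ * adj i) * h (σ * adj i) else 0) * g σ ^ 2 := by
          rw [sum_comm]
          simp only [sum_mul, ite_mul, zero_mul]
      _ ≤ ∑ σ, (1 - δ) * (π σ * h σ) * g σ ^ 2 := by
          refine sum_le_sum fun σ _ => mul_le_mul_of_nonneg_right ?_ (sq_nonneg _)
          have := sum_sortStep_le team s (q := q) (H := H) hs hq
            (by rw [← hδ, hHδ]; linarith) (by linarith) h01 h02 h12 σ
          rwa [show q + 1 / 2 = 1 - δ by rw [hδ]; ring] at this
      _ = (1 - δ) * S := by
          simp only [S, mul_sum, mul_assoc]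
  have hpoint : ∀ σ, π σ * h σ * g σ ^ 2 ≤
      (if σ ∈ sortedPerms team then H * (π σ * g σ ^ 2) else 0) +
      (1 + 2 / δ) * H * (π σ * ∑ i : Fin m, (f σ - f (σ * adj i)) ^ 2) +
      (1 + δ / 2) * F σ := by
    intro σ
    have hp := hπ0 σ
    have hh := hhH σ
    have hE : 0 ≤ ∑ i : Fin m, (f σ - f (σ * adj i)) ^ 2 := sum_nonneg fun _ _ => sq_nonneg _
    have hH0 : 0 < H := by linarith
    have hFσ := hF0 σ
    by_cases hσ : σ ∈ sortedPerms team
    · rw [if_pos hσ]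
      have h1 : 0 ≤ (1 + 2 / δ) * H * (π σ * ∑ i : Fin m, (f σ - f (σ * adj i)) ^ 2) := by
        positivity
      have h2 : 0 ≤ (1 + δ / 2) * F σ := by positivity
      have h3 := mul_le_mul_of_nonneg_right hh (by positivity : 0 ≤ π σ * g σ ^ 2)
      linarith
    · rw [if_neg hσ, zero_add]
      obtain ⟨i, hi⟩ := exists_sortStep team hσ
      have h0 : 0 < π σ * h σ := mul_pos hp (by linarith [hh1 σ])
      have h1 : π σ * h σ * g (σ * adj i) ^ 2 ≤ F σ := by
        have := single_le_sum (f := fun i : Fin m =>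
          if SortStep team σ i then π σ * h σ * g (σ * adj i) ^ 2 else 0)
          (fun i _ => by split_ifs <;> positivity) (mem_univ i)
        simpa only [if_pos hi] using this
      have h2 : (f σ - f (σ * adj i)) ^ 2 ≤ ∑ i : Fin m, (f σ - f (σ * adj i)) ^ 2 :=
        single_le_sum (f := fun i => (f σ - f (σ * adj i)) ^ 2)
          (fun _ _ => sq_nonneg _) (mem_univ i)
      have h3 : g σ ^ 2 ≤ (1 + 2 / δ) * (f σ - f (σ * adj i)) ^ 2 +
          (1 + δ / 2) * g (σ * adj i) ^ 2 := by
        have e : (1 + 2 / δ) * (f σ - f (σ * adj i)) ^ 2 + (1 + δ / 2) * g (σ * adj i) ^ 2 -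
            g σ ^ 2 = δ / 2 * (2 / δ * (f σ - f (σ * adj i)) - g (σ * adj i)) ^ 2 := by
          simp only [g]
          field_simp
          ring
        have : 0 ≤ δ / 2 * (2 / δ * (f σ - f (σ * adj i)) - g (σ * adj i)) ^ 2 := by positivity
        linarith
      calc π σ * h σ * g σ ^ 2 ≤ π σ * h σ * ((1 + 2 / δ) * (f σ - f (σ * adj i)) ^ 2 +
            (1 + δ / 2) * g (σ * adj i) ^ 2) := mul_le_mul_of_nonneg_left h3 h0.le
        _ = (1 + 2 / δ) * (h σ * (π σ * (f σ - f (σ * adj i)) ^ 2)) +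
            (1 + δ / 2) * (π σ * h σ * g (σ * adj i) ^ 2) := by ring
        _ ≤ (1 + 2 / δ) * (H * (π σ * ∑ i : Fin m, (f σ - f (σ * adj i)) ^ 2)) +
            (1 + δ / 2) * F σ := by gcongr
        _ = _ := by ring
  have hS : S ≤ H * ∑ σ ∈ sortedPerms team, π σ * g σ ^ 2 +
      (1 + 2 / δ) * H * energy team s f + (1 + δ / 2) * ∑ σ, F σ := by
    refine (sum_le_sum fun σ _ => hpoint σ).trans (le_of_eq ?_)
    rw [sum_add_distrib, sum_add_distrib, ← mul_sum, ← mul_sum, mul_sum (sortedPerms team)]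
    simp [energy, hπ]
  have hS0 : 0 ≤ S := (sum_nonneg fun σ _ => mul_nonneg (hπ0 σ).le (sq_nonneg _)).trans hvar
  have h1 : δ / 2 * S ≤ H * ((4 * ((m : ℝ) + 1) ^ 4 + 1 + 2 / δ) * energy team s f) := by
    have h2 := mul_le_mul_of_nonneg_left hc (by linarith : 0 ≤ H)
    have h3 := mul_le_mul_of_nonneg_left hF (by linarith : 0 ≤ 1 + δ / 2)
    have h4 : 0 ≤ δ ^ 2 / 2 * S := by positivity
    have h5 : (1 + δ / 2) * ((1 - δ) * S) = S - δ / 2 * S - δ ^ 2 / 2 * S := by ring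
    change H * ∑ σ ∈ sortedPerms team, π σ * g σ ^ 2 ≤ _ at h2
    linarith
  refine hvar.trans ?_
  have h6 := mul_le_mul_of_nonneg_left h1 (by positivity : 0 ≤ 2 / δ)
  have e1 : 2 / δ * (δ / 2 * S) = S := by field_simp
  rw [e1] at h6
  refine h6.trans (le_of_eq ?_)
  simp only [H]
  field_simp

end Sorting

section Mixing

variable {m k : ℕ}

lemma le_swapProb_mul (team : Fin (m + 1) → Fin k) (s : Fin k → ℝ) (hs : ∀ j, 0 < s j) {Q : ℝ}
    (hQ0 : 0 < Q) (hQ : ∀ i j, Q * s j ≤ s i) (i : Fin m) (σ : Equiv.Perm (Fin (m + 1))) :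
    Q / 4 ≤ swapProb team s i σ * (1 - swapProb team s i σ) := by
  rw [one_sub_swapProb team s hs, swapProb]
  have h1 := hQ (team (σ i.castSucc)) (team (σ i.succ))
  have h2 := hQ (team (σ i.succ)) (team (σ i.castSucc))
  have ha := hs (team (σ i.castSucc))
  have hb := hs (team (σ i.succ))
  generalize s (team (σ i.castSucc)) = a at *
  generalize s (team (σ i.succ)) = b at *
  rw [div_mul_div_comm, div_le_div_iff₀ (by norm_num) (by positivity)]
  rcases le_total a b with h | h
  · have e1 : (a + b) * (a + b) ≤ 4 * (b * b) := by nlinarith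
    have e2 := mul_le_mul_of_nonneg_left e1 hQ0.le
    have e3 := mul_le_mul_of_nonneg_right h1 hb.le
    linarith
  · have e1 : (a + b) * (a + b) ≤ 4 * (a * a) := by nlinarith
    have e2 := mul_le_mul_of_nonneg_left e1 hQ0.le
    have e3 := mul_le_mul_of_nonneg_right h2 ha.le
    linarith

lemma exp_le_gladPi (team : Fin (m + 1) → Fin k) (s : Fin k → ℝ) (hs : ∀ j, 0 < s j) {Q : ℝ}
    (hQ0 : 0 < Q) (hQ1 : Q ≤ 1) (hQ : ∀ i j, Q * s j ≤ s i) (σ : Equiv.Perm (Fin (m + 1))) :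
    Real.exp (-((1 - Real.log Q) * ((m : ℝ) + 1) ^ 2)) ≤ gladPi (m + 1) k team s σ := by
  have hw : ∀ τ, Q ^ ((m + 1) ^ 2) * gladW (m + 1) k team s τ ≤ gladW (m + 1) k team s σ := by
    intro τ
    rw [gladW_eq, gladW_eq]
    have e : Q ^ ((m + 1) ^ 2) = ∏ _a : Fin (m + 1), Q ^ (m + 1) := by
      rw [prod_const, card_univ, Fintype.card_fin, ← pow_mul, sq]
    rw [e, ← prod_mul_distrib]
    refine prod_le_prod (fun a _ => mul_nonneg (by positivity) (pow_pos (hs _) _).le)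
      fun a _ => ?_
    calc Q ^ (m + 1) * s (team (τ a)) ^ ((a : ℕ) + 1)
        ≤ Q ^ ((a : ℕ) + 1) * s (team (τ a)) ^ ((a : ℕ) + 1) :=
          mul_le_mul_of_nonneg_right (pow_le_pow_of_le_one hQ0.le hQ1 a.isLt)
            (pow_pos (hs _) _).le
      _ = (Q * s (team (τ a))) ^ ((a : ℕ) + 1) := (mul_pow _ _ _).symm
      _ ≤ s (team (σ a)) ^ ((a : ℕ) + 1) :=
          pow_le_pow_left₀ (mul_pos hQ0 (hs _)).le (hQ _ _) _
  have hZ : 0 < ∑ τ, gladW (m + 1) k team s τ :=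
    sum_pos (fun τ _ => gladW_pos team s hs τ) univ_nonempty
  have hfact : ((Nat.factorial (m + 1) : ℕ) : ℝ) ≤ Real.exp (((m : ℝ) + 1) ^ 2) := by
    have h1 : ((Nat.factorial (m + 1) : ℕ) : ℝ) ≤ ((m : ℝ) + 1) ^ (m + 1) := by
      exact_mod_cast Nat.factorial_le_pow (m + 1)
    have h2 : (m : ℝ) + 1 ≤ Real.exp ((m : ℝ) + 1) := by
      linarith [Real.add_one_le_exp ((m : ℝ) + 1)]
    refine h1.trans ((pow_le_pow_left₀ (by positivity) h2 _).trans (le_of_eq ?_))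
    rw [← Real.exp_nat_mul]
    push_cast
    rw [sq]
  have hsum : Q ^ ((m + 1) ^ 2) * ∑ τ, gladW (m + 1) k team s τ ≤
      Real.exp (((m : ℝ) + 1) ^ 2) * gladW (m + 1) k team s σ := by
    rw [mul_sum]
    refine (sum_le_sum fun τ _ => hw τ).trans ?_
    rw [sum_const, card_univ, Fintype.card_perm, Fintype.card_fin, nsmul_eq_mul]
    exact mul_le_mul_of_nonneg_right hfact (gladW_pos team s hs σ).le
  have hQe : Q ^ ((m + 1) ^ 2) = Real.exp (Real.log Q * ((m : ℝ) + 1) ^ 2) := by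
    rw [← Real.rpow_natCast, Real.rpow_def_of_pos hQ0]
    push_cast
    rfl
  unfold gladPi
  rw [le_div_iff₀ hZ]
  have e : Real.exp (-((1 - Real.log Q) * ((m : ℝ) + 1) ^ 2)) =
      Real.exp (-((m : ℝ) + 1) ^ 2) * Q ^ ((m + 1) ^ 2) := by
    rw [hQe, ← Real.exp_add]
    congr 1
    ring
  rw [e, mul_assoc]
  have h3 := mul_le_mul_of_nonneg_left hsum (Real.exp_pos (-((m : ℝ) + 1) ^ 2)).le
  rwa [← mul_assoc, ← mul_assoc, ← Real.exp_add, neg_add_cancel, Real.exp_zero, one_mul,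
    mul_assoc] at h3

lemma mixingTime_eq_zero_of_le_one {n : ℕ} (hn : n ≤ 1) (team : Fin n → Fin k) (s : Fin k → ℝ)
    (hs : ∀ j, 0 < s j) : mixingTime (gladP n k team s) (gladPi n k team s) = 0 := by
  have hsub : Subsingleton (Fin n) := by
    interval_cases n <;> infer_instance
  have hP : gladP n k team s = 0 := by
    ext σ τ
    have h : ∀ i j : Fin n, ¬ (j : ℕ) = (i : ℕ) + 1 := fun i j => by omega
    simp [gladP, h]
  have hsum : ∑ σ, gladPi n k team s σ = 1 := by
    unfold gladPi
    rw [← sum_div]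
    exact div_self
      (sum_pos (fun τ _ => prod_pos fun _ _ => pow_pos (hs _) _) univ_nonempty).ne'
  unfold mixingTime
  convert Nat.sInf_empty
  rw [Set.eq_empty_iff_forall_notMem]
  intro T hT
  have h := hT 1 (T + 1) (Nat.le_succ T)
  rw [hP, zero_pow (Nat.succ_ne_zero T)] at h
  have h2 : ∑ σ, gladPi n k team s σ ≤
      ∑ y, |(0 : Matrix (Equiv.Perm (Fin n)) (Equiv.Perm (Fin n)) ℝ) 1 y -
        gladPi n k team s y| :=
    sum_le_sum fun σ _ => by
      rw [Matrix.zero_apply, zero_sub, abs_neg]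
      exact le_abs_self _
  linarith

/-- The constant in the mixing time bound. -/
noncomputable def mixingConst (q Q : ℝ) : ℝ :=
  (3 - Real.log Q) * (2 / (1 / 2 - q) ^ 2 * (5 + 2 / (1 / 2 - q))) / (Q / 4) + 1

lemma mixingConst_pos {q Q : ℝ} (hq2 : q < 1 / 2) (hQ0 : 0 < Q) (hQ1 : Q ≤ 1) :
    0 < mixingConst q Q := by
  have h1 : 0 < 1 / 2 - q := by linarith
  have h2 : 0 < 3 - Real.log Q := by linarith [Real.log_nonpos hQ0.le hQ1]
  unfold mixingConst
  positivity

lemma mixingTime_le (n : ℕ) (team : Fin n → Fin 3) (s : Fin 3 → ℝ) (hs : ∀ j, 0 < s j)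
    {q Q : ℝ} (hq : 0 < q) (hq2 : q < 1 / 2) (hQ0 : 0 < Q) (hQ1 : Q ≤ 1)
    (hQ : ∀ i j, Q * s j ≤ s i) (h01 : s 0 ≤ q * s 1) (h02 : s 0 ≤ q * s 2)
    (h12 : s 1 ≤ q * s 2) :
    (mixingTime (gladP n 3 team s) (gladPi n 3 team s) : ℝ) ≤
      mixingConst q Q * (n : ℝ) ^ 18 := by
  rcases le_or_gt n 1 with hn | hn
  · rw [mixingTime_eq_zero_of_le_one hn team s hs, Nat.cast_zero]
    have := mixingConst_pos hq2 hQ0 hQ1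
    positivity
  obtain ⟨m, rfl⟩ : ∃ m, n = m + 1 := ⟨n - 1, by omega⟩
  have hm : 0 < m := by omega
  have hm' : (0 : ℝ) < m := by exact_mod_cast hm
  have hδ : 0 < 1 / 2 - q := by linarith
  have hB : 0 < 1 - Real.log Q := by linarith [Real.log_nonpos hQ0.le hQ1]
  set B := 1 - Real.log Q with hBdef
  set K := 2 / (1 / 2 - q) ^ 2 * (5 + 2 / (1 / 2 - q)) with hK
  have hK0 : 0 < K := by positivity
  set N : ℝ := (m : ℝ) + 1 with hN
  have hN1 : 1 ≤ N := by linarith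
  let γ := Q / 4 / (K * N ^ 5)
  have hγ : 0 < γ := by positivity
  have hdecay : ∀ f : Equiv.Perm (Fin (m + 1)) → ℝ,
      ∑ x, gladPi (m + 1) 3 team s x * f x = 0 →
      ∑ x, gladPi (m + 1) 3 team s x * (gladP (m + 1) 3 team s).mulVec f x ^ 2 ≤
        Real.exp (-γ) * ∑ x, gladPi (m + 1) 3 team s x * f x ^ 2 := by
    intro f hf
    have h1 := sum_gladPi_mulVec_sq_le team s hm hs (Q / 4)
      (fun i σ => le_swapProb_mul team s hs hQ0 hQ i σ) f
    have h2 := poincare team s hs hq hq2 h01 h02 h12 f hf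
    have hE : 0 ≤ energy team s f := sum_nonneg fun σ _ =>
      mul_nonneg (gladPi_pos team s hs σ).le (sum_nonneg fun _ _ => sq_nonneg _)
    set V := ∑ x, gladPi (m + 1) 3 team s x * f x ^ 2
    have hV : 0 ≤ V := sum_nonneg fun σ _ =>
      mul_nonneg (gladPi_pos team s hs σ).le (sq_nonneg _)
    have h3 : V ≤ K * N ^ 4 * energy team s f := by
      refine h2.trans (mul_le_mul_of_nonneg_right ?_ hE)
      rw [hK, mul_assoc]
      refine mul_le_mul_of_nonneg_left ?_ (by positivity)
      have h4 : 1 ≤ N ^ 4 := one_le_pow₀ hN1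
      have h5 : 2 / (1 / 2 - q) ≤ 2 / (1 / 2 - q) * N ^ 4 :=
        le_mul_of_one_le_right (by positivity) h4
      linarith
    have h6 : γ * V ≤ Q / 4 / m * energy team s f := by
      calc γ * V ≤ γ * (K * N ^ 4 * energy team s f) := mul_le_mul_of_nonneg_left h3 hγ.le
        _ = Q / 4 / N * energy team s f := by
          simp only [γ]
          field_simp
        _ ≤ Q / 4 / m * energy team s f := by
          gcongr
          linarith
    have h7 := mul_le_mul_of_nonneg_right (Real.add_one_le_exp (-γ)) hV
    linarith
  let T := ⌈(B * N ^ 2 + 2) / γ⌉₊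
  have hT : mixingTime (gladP (m + 1) 3 team s) (gladPi (m + 1) 3 team s) ≤ T := by
    refine Nat.sInf_le ?_
    intro x t ht
    have h1 := sq_sum_abs_pow_sub_le (gladP (m + 1) 3 team s) (gladPi (m + 1) 3 team s)
      (Real.exp (-γ)) (Real.exp_pos _).le (gladPi_pos team s hs) (sum_gladPi team s hs)
      (gladP_mulVec_one team s hm hs) (sum_gladPi_mulVec team s hm hs) hdecay x t
    have h2 : B * N ^ 2 + 2 ≤ γ * t := by
      have h3 : (B * N ^ 2 + 2) / γ ≤ t :=
        (Nat.le_ceil _).trans (by exact_mod_cast ht)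
      rw [div_le_iff₀ hγ] at h3
      linarith
    have h3 := exp_le_gladPi team s hs hQ0 hQ1 hQ x
    set D := ∑ y, |(gladP (m + 1) 3 team s ^ t) x y - gladPi (m + 1) 3 team s y|
    have hexp2 : 4 ≤ Real.exp 2 := by
      have h4 := Real.add_one_le_exp (1 : ℝ)
      rw [show (2 : ℝ) = 1 + 1 by norm_num, Real.exp_add]
      nlinarith
    have h5 : Real.exp (-(B * N ^ 2)) * D ^ 2 ≤ Real.exp (-(B * N ^ 2)) * Real.exp (-2) := by
      refine (mul_le_mul_of_nonneg_right h3 (sq_nonneg D)).trans (h1.trans ?_)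
      rw [← Real.exp_nat_mul, ← Real.exp_add]
      exact Real.exp_le_exp.2 (by linarith)
    have h6 : D ^ 2 ≤ Real.exp (-2) := le_of_mul_le_mul_left h5 (Real.exp_pos _)
    have h7 : Real.exp (-2) ≤ 1 / 4 := by
      rw [Real.exp_neg, ← one_div]
      exact one_div_le_one_div_of_le (by norm_num) hexp2
    have h8 : D ≤ 1 / 2 := abs_le_of_sq_le_sq' (by linarith) (by norm_num) |>.2
    linarith
  have hTle : (T : ℝ) ≤ (B * N ^ 2 + 2) / γ + 1 := (Nat.ceil_lt_add_one (by positivity)).le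
  have hTC : (mixingTime (gladP (m + 1) 3 team s) (gladPi (m + 1) 3 team s) : ℝ) ≤ T := by
    exact_mod_cast hT
  refine hTC.trans (hTle.trans ?_)
  have hcast : ((m + 1 : ℕ) : ℝ) = N := by push_cast; rfl
  have hconst : mixingConst q Q = (B + 2) * K / (Q / 4) + 1 := by
    rw [mixingConst, hBdef, hK]
    ring
  rw [hcast, hconst]
  have hN2 : 1 ≤ N ^ 2 := one_le_pow₀ hN1
  calc (B * N ^ 2 + 2) / γ + 1 ≤ ((B + 2) * N ^ 2) / γ + 1 := by
        gcongr
        linarith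
    _ = (B + 2) * K / (Q / 4) * N ^ 7 + 1 := by
        simp only [γ]
        field_simp
    _ ≤ (B + 2) * K / (Q / 4) * N ^ 18 + N ^ 18 := by
        gcongr
        · norm_num
        · exact one_le_pow₀ hN1
    _ = _ := by ring

end Mixing

end Gladiator

/-- For the gladiator chain `G₃(n)` on `S_n` with three teams
(`team g = 0` meaning team `A`, `1` team `B`, `2` team `C`) whose strengths satisfy
`0 < s_A < s_B < s_C`, `s_A/s_B < 1/2` and `s_B/s_C < 1/2`, there is a constant `C`
depending only on the ratios `s_A/s_B` and `s_B/s_C` (and not on `n` or the team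
sizes) with `t(G₃(n)) ≤ C·n¹⁸`. -/
theorem gladiator_three_teams_mixing (qAB qBC : ℝ) :
    ∃ C : ℝ, 0 < C ∧
      ∀ (n : ℕ) (team : Fin n → Fin 3) (sA sB sC : ℝ),
        0 < sA → sA < sB → sB < sC →
        sA / sB = qAB → sB / sC = qBC → qAB < 1 / 2 → qBC < 1 / 2 →
        (mixingTime (gladP n 3 team ![sA, sB, sC])
            (gladPi n 3 team ![sA, sB, sC]) : ℝ) ≤
          C * (n : ℝ) ^ 18 := by
  by_cases hq : 0 < qAB ∧ 0 < qBC ∧ qAB < 1 / 2 ∧ qBC < 1 / 2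
  · obtain ⟨hAB0, hBC0, hAB, hBC⟩ := hq
    have hq0 : 0 < max qAB qBC := lt_max_of_lt_left hAB0
    have hq2 : max qAB qBC < 1 / 2 := max_lt hAB hBC
    have hQ0 : 0 < qAB * qBC := mul_pos hAB0 hBC0
    have hQA : qAB * qBC ≤ qAB := mul_le_of_le_one_right hAB0.le (by linarith)
    have hQB : qAB * qBC ≤ qBC := mul_le_of_le_one_left hBC0.le (by linarith)
    refine ⟨_, Gladiator.mixingConst_pos hq2 hQ0 (by linarith), ?_⟩
    intro n team sA sB sC hA0 hlt1 hlt2 h1 h2 _ _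
    have hB0 : 0 < sB := hA0.trans hlt1
    have hC0 : 0 < sC := hB0.trans hlt2
    rw [div_eq_iff hB0.ne'] at h1
    rw [div_eq_iff hC0.ne'] at h2
    have hmA : qAB ≤ max qAB qBC := le_max_left _ _
    have hmB : qBC ≤ max qAB qBC := le_max_right _ _
    have e1 : sA ≤ max qAB qBC * sB := h1.le.trans (mul_le_mul_of_nonneg_right hmA hB0.le)
    have e2 : sB ≤ max qAB qBC * sC := h2.le.trans (mul_le_mul_of_nonneg_right hmB hC0.le)
    have e3 : sA ≤ max qAB qBC * sC := hlt1.le.trans e2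
    have hQC : qAB * qBC * sC = sA := by rw [mul_assoc, ← h2, ← h1]
    refine Gladiator.mixingTime_le n team ![sA, sB, sC] ?_ hq0 hq2 hQ0 (by linarith) ?_
      (by simpa using e1) (by simpa using e3) (by simpa using e2)
    · intro j
      fin_cases j <;> simpa
    · have hle : ∀ j, ![sA, sB, sC] j ≤ sC := by
        intro j
        fin_cases j <;> simp <;> linarith
      have hge : ∀ j, sA ≤ ![sA, sB, sC] j := by
        intro j
        fin_cases j <;> simp <;> linarith
      intro i j
      exact ((mul_le_mul_of_nonneg_left (hle j) hQ0.le).trans hQC.le).trans (hge i)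
  · refine ⟨1, one_pos, ?_⟩
    intro n team sA sB sC hA0 hlt1 hlt2 h1 h2 hAB hBC
    have hB0 : 0 < sB := hA0.trans hlt1
    have hC0 : 0 < sC := hB0.trans hlt2
    exact absurd ⟨h1 ▸ div_pos hA0 hB0, h2 ▸ div_pos hB0 hC0, hAB, hBC⟩ hq
end
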